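/- If B is a Boolean algebra of cardinality ≥ ℶ_ω and λ is the cardinality of the set of ideals of B, then λ = λ^{ℶ_ω}. -/

import Mathlib

universe u

section
open Cardinal Set
namespace Sh

theorem iio_lt (c : Cardinal.{u}) (i : c.ord.ToType) : #(Set.Iio i) < c :=
  by simpa using mk_Iio_lt i (by simp)

theorem iic_lt {c : Cardinal.{u}} (hc : ℵ₀ ≤ c) (i : c.ord.ToType) : #(Set.Iic i) < c := by
  have h : Set.Iic i ⊆ insert i (Set.Iio i) := by
    intro x hx
    rcases lt_or_eq_of_le (show x ≤ i from hx) with h | h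
    · exact Or.inr h
    · exact Or.inl h
  calc #(Set.Iic i) ≤ #(insert i (Set.Iio i) : Set _) := mk_le_mk_of_subset h
    _ ≤ #(Set.Iio i) + 1 := mk_insert_le
    _ < c := add_lt_of_lt hc (iio_lt c i) (one_lt_aleph0.trans_le hc)

theorem exists_strictMono {c : Cardinal.{u}} {A : Type u} [LinearOrder A] [WellFoundedLT A]
    (h : c ≤ #A) : ∃ f : c.ord.ToType → A, StrictMono f := by
  have h1 : Ordinal.type (α := c.ord.ToType) (· < ·) ≤ Ordinal.type (α := A) (· < ·) := by
    rw [Ordinal.type_toType]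
    exact (ord_le_ord.2 h).trans (ord_le_type _)
  obtain ⟨f⟩ := Ordinal.type_le_iff'.1 h1
  exact ⟨f, fun a b hab => f.map_rel_iff.2 hab⟩

theorem exists_strictMono' {J A : Type u} [LinearOrder J] [WellFoundedLT J]
    [LinearOrder A] [WellFoundedLT A]
    (h : #J < #A) : ∃ f : J → A, StrictMono f := by
  have h1 : Ordinal.type (α := J) (· < ·) ≤ Ordinal.type (α := A) (· < ·) := by
    by_contra hc
    have := Ordinal.card_le_card (le_of_not_ge hc)
    simp at this
    exact absurd h (not_lt.2 this)
  obtain ⟨f⟩ := Ordinal.type_le_iff'.1 h1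
  exact ⟨f, fun a b hab => f.map_rel_iff.2 hab⟩

theorem sum_le_prod {ι : Type u} (c : ι → Cardinal.{u}) :
    Cardinal.sum c ≤ Cardinal.prod (fun i => c i + 1) := by
  classical
  have : ∀ i, c i = #(c i).out := fun i => (mk_out _).symm
  have e1 : Cardinal.sum c = #(Σ i, (c i).out) := by simp
  have e2 : Cardinal.prod (fun i => c i + 1) = #(∀ i, Option (c i).out) := by simp
  rw [e1, e2]
  refine mk_le_of_injective (f := fun p i => if h : i = p.1 then some (h ▸ p.2) else none) ?_
  rintro ⟨i, x⟩ ⟨j, y⟩ h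
  have h1 := congrFun h i
  by_cases hij : i = j
  · subst hij
    simp at h1
    simp [h1]
  · simp [hij] at h1

theorem prod_power {ι : Type u} (c : ι → Cardinal.{u}) (k : Cardinal.{u}) :
    Cardinal.prod (fun i => c i ^ k) = (Cardinal.prod c) ^ k := by
  induction k using Cardinal.inductionOn with | _ K =>
  have e1 : Cardinal.prod (fun i => c i ^ #K) = #(∀ i, (K → (c i).out)) := by simp
  have e2 : (Cardinal.prod c) ^ #K = #(K → ∀ i, (c i).out) := by simp
  rw [e1, e2]
  exact mk_congr ⟨fun f k i => f i k, fun f i k => f k i, fun _ => rfl, fun _ => rfl⟩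

theorem cofDich (χ z : Cardinal.{u}) (hχ : ℵ₀ ≤ χ) :
    (∃ (ι : Type u) (c : ι → Cardinal.{u}), #ι = z ∧ (∀ j, c j < χ) ∧ χ ≤ Cardinal.sum c) ∨
    (∀ ν, (∀ α < χ, α ^ z ≤ ν) → χ ^ z ≤ χ * ν) := by
  induction z using Cardinal.inductionOn with | _ ι =>
  by_cases h : ∃ f : ι → χ.ord.ToType, ∀ b, ∃ j, b ≤ f j
  · left
    obtain ⟨f, hf⟩ := h
    refine ⟨ι, fun j => #(Set.Iic (f j)), rfl, fun j => iic_lt hχ _, ?_⟩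
    rw [← mk_sigma]
    conv_lhs => rw [← mk_ord_toType χ]
    refine mk_le_of_surjective (f := fun p : (Σ j, Set.Iic (f j)) => p.2.1) ?_
    intro b
    obtain ⟨j, hj⟩ := hf b
    exact ⟨⟨j, b, hj⟩, rfl⟩
  · right
    push Not at h
    intro ν hν
    have e : χ ^ #ι = #(ι → χ.ord.ToType) := by simp
    choose b hb using h
    have : #(ι → χ.ord.ToType) ≤ #(Σ b : χ.ord.ToType, (ι → Set.Iio b)) := by
      refine mk_le_of_injective (f := fun f => ⟨b f, fun j => ⟨f j, hb f j⟩⟩) ?_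
      intro f g hfg
      have h2 := congrArg (fun p : (Σ b : χ.ord.ToType, (ι → Set.Iio b)) =>
        fun j => (p.2 j).1) hfg
      exact h2
    rw [e]
    refine this.trans ?_
    rw [mk_sigma]
    calc Cardinal.sum (fun b : χ.ord.ToType => #(ι → Set.Iio b))
        ≤ Cardinal.sum (fun b : χ.ord.ToType => ν) := by
          apply Cardinal.sum_le_sum
          intro b
          have := hν _ (iio_lt χ b)
          simpa using this
      _ = χ * ν := by simp

/-- the power of a small-cofinality cardinal -/
theorem pow_le_of_cof {ι : Type u} {c : ι → Cardinal.{u}} {χ n : Cardinal.{u}}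
    (h : χ ≤ Cardinal.sum c) (hc : ∀ i, (c i + 1) ^ n ≤ χ) : χ ^ n ≤ χ ^ #ι := by
  calc χ ^ n ≤ (Cardinal.prod (fun i => c i + 1)) ^ n :=
        power_le_power_right (h.trans (sum_le_prod c))
    _ = Cardinal.prod (fun i => (c i + 1) ^ n) := (prod_power _ _).symm
    _ ≤ Cardinal.prod (fun _ : ι => χ) := Cardinal.prod_le_prod _ _ hc
    _ = χ ^ #ι := by simp

section tree
variable {X C ι : Type*} [LinearOrder ι] [WellFoundedLT ι]

/-- the tree of cells -/
noncomputable def cell (s : Set X → X → C) (x : X) : ι → Set X :=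
  (wellFounded_lt (α := ι)).fix
    (fun i rec => {z | ∀ j (h : j < i), s (rec j h) z = s (rec j h) x})

theorem cell_eq (s : Set X → X → C) (x : X) (i : ι) :
    cell s x i = {z | ∀ j < i, s (cell s x j) z = s (cell s x j) x} := by
  rw [cell, WellFounded.fix_eq]

theorem mem_cell {s : Set X → X → C} {x z : X} {i : ι} :
    z ∈ cell s x i ↔ ∀ j < i, s (cell s x j) z = s (cell s x j) x := by
  rw [cell_eq]; rfl

theorem self_mem_cell (s : Set X → X → C) (x : X) (i : ι) : x ∈ cell s x i :=
  mem_cell.2 fun _ _ => rfl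

theorem cell_anti (s : Set X → X → C) (x : X) {i j : ι} (h : i ≤ j) :
    cell s x j ⊆ cell s x i := fun _ hz =>
  mem_cell.2 fun k hk => mem_cell.1 hz k (hk.trans_le h)

theorem cell_congr (s : Set X → X → C) {x z : X} {i : ι} 
    (h : ∀ j < i, s (cell s x j) z = s (cell s x j) x) : cell s z i = cell s x i := by
  induction i using WellFoundedLT.induction with | _ i ih =>
  have h2 : ∀ j < i, cell s z j = cell s x j := fun j hj =>
    ih j hj (fun k hk => h k (hk.trans hj))
  ext w
  rw [mem_cell, mem_cell]
  refine forall₂_congr fun j hj => ?_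
  rw [h2 j hj, h j hj]

/-- if codes agree then cells agree -/
theorem cell_congr_code (s : Set X → X → C) {x z : X} {i : ι} 
    (h : ∀ j < i, s (cell s z j) z = s (cell s x j) x) : cell s z i = cell s x i := by
  induction i using WellFoundedLT.induction with | _ i ih =>
  have h2 : ∀ j < i, cell s z j = cell s x j := fun j hj =>
    ih j hj (fun k hk => h k (hk.trans hj))
  ext w
  rw [mem_cell, mem_cell]
  refine forall₂_congr fun j hj => ?_
  rw [h j hj, h2 j hj]

end tree

/-- Erdos-Rado -/
theorem erdosRado {C T J : Type u} [LinearOrder T] [WellFoundedLT T] [LinearOrder J]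
    [WellFoundedLT J] {θ : Cardinal.{u}} (hθ : θ.IsRegular) (hC : #C < θ) (hJ : #J < θ)
    (hT : (#C + 1) ^ θ < #T) (f : T → T → C) :
    ∃ h : J → T, StrictMono h ∧ ∃ c, ∀ a b, a < b → f (h a) (h b) = c := by
  classical
  let ι := θ.ord.ToType
  have hne : Nonempty T := by
    rw [← mk_ne_zero_iff]; exact (bot_le.trans_lt hT).ne'
  let m : Set T → T := fun K => if h : K.Nonempty then wellFounded_lt.min K h else hne.some
  have hm : ∀ K : Set T, K.Nonempty → m K ∈ K := fun K h => by
    simp only [m, dif_pos h]; exact WellFounded.min_mem _ _ _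
  have hm2 : ∀ K : Set T, ∀ z ∈ K, m K ≤ z := fun K z hz => by
    have h : K.Nonempty := ⟨z, hz⟩
    have h2 : m K = wellFounded_lt.min K h := dif_pos h
    rw [h2]
    exact WellFounded.min_le _ hz
  let s : Set T → T → Option C := fun K z => if z = m K then none else some (f (m K) z)
  have : ¬ Function.Injective (fun (x : T) (i : ι) => s (cell s x i) x) := by
    intro hinj
    have := mk_le_of_injective hinj
    simp [ι] at this
    exact absurd hT (not_lt.2 this)
  simp only [Function.Injective, not_forall] at this
  obtain ⟨x, z, hxz, hne⟩ := this
  have hc : ∀ i : ι, cell s z i = cell s x i := fun i =>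
    cell_congr_code s fun j _ => (congrFun hxz j).symm
  have hcx : ∀ i : ι, m (cell s x i) ≠ x := by
    intro i hi
    have h1 := congrFun hxz i
    simp only [hc] at h1
    simp only [s, hi, if_true] at h1
    by_cases h2 : z = x
    · exact hne h2.symm
    · simp [h2] at h1
  let w : ι → T := fun i => m (cell s x i)
  have hw1 : ∀ i j : ι, i < j → w i < w j ∧ f (w i) (w j) = f (w i) x := by
    intro i j hij
    have h1 : w j ∈ cell s x j := hm _ ⟨x, self_mem_cell s x j⟩
    have h2 : s (cell s x i) (w j) = s (cell s x i) x := mem_cell.1 h1 i hij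
    have h3 : s (cell s x i) x = some (f (w i) x) := by
      simp only [s, w, if_neg (hcx i).symm]
    rw [h3] at h2
    have h4 : w j ≠ w i := by
      intro h4
      simp only [s, h4, w, if_true] at h2
      cases h2
    have h4' : ¬ w j = m (cell s x i) := h4
    simp only [s, if_neg h4', Option.some.injEq] at h2
    refine ⟨lt_of_le_of_ne (hm2 _ _ (cell_anti s x hij.le h1)) h4.symm, h2⟩
  have hιc : #ι = θ := mk_ord_toType θ
  obtain ⟨c, hc⟩ := Cardinal.infinite_pigeonhole_card (fun i : ι => f (w i) x) θ hιc.ge hθ.1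
    (by rw [hθ.cof_ord]; exact hC)
  obtain ⟨g, hg⟩ := exists_strictMono' (J := J)
    (A := ((fun i : ι => f (w i) x) ⁻¹' {c} : Set ι)) (hJ.trans_le hc)
  refine ⟨fun a => w (g a), fun a b hab => (hw1 _ _ (hg hab)).1, c, fun a b hab => ?_⟩
  rw [(hw1 _ _ (hg hab)).2]
  exact (g a).2

end Sh
end

section
open Cardinal Set
namespace Sh

theorem pairing {N : Cardinal.{u}} (hN : ℵ₀ ≤ N) :
    ∃ G : N.ord.ToType → N.ord.ToType → N.ord.ToType, (∀ b n, b ≤ G b n) ∧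
      ∀ b n b' n', G b n = G b' n' → b = b' ∧ n = n' := by
  have h : #(N.ord.ToType × N.ord.ToType) = #N.ord.ToType := by
    simp [mul_eq_self hN]
  obtain ⟨e⟩ := Cardinal.eq.1 h
  let A : N.ord.ToType → Set N.ord.ToType := fun n => range (fun b => e (b, n))
  have hA : ∀ n, N ≤ #(A n) := by
    intro n
    rw [mk_range_eq]
    · simp
    · intro a b hab
      simpa using hab
  have : ∀ n, ∃ f : N.ord.ToType → A n, StrictMono f := fun n => exists_strictMono (hA n)
  choose f hf using this
  refine ⟨fun b n => f n b, fun b n => ?_, ?_⟩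
  · exact StrictMono.le_apply (f := fun b => (f n b : N.ord.ToType)) (fun x y h => hf n h)
  · intro b n b' n' h
    obtain ⟨c, hc⟩ := (f n b).2
    obtain ⟨c', hc'⟩ := (f n' b').2
    have hn : n = n' := by
      have : e (c, n) = e (c', n') := by
        simp only at hc hc' h
        rw [hc, hc', h]
      have := e.injective this
      simp at this
      exact this.2
    subst hn
    exact ⟨(hf n).injective (Subtype.ext h), rfl⟩

theorem splitting {ι : Type u} (q : ι → Cardinal.{u}) {N : Cardinal.{u}} (hN : ℵ₀ ≤ N) :
    ∃ Z : Set ι, #Z < N ∧ ∃ φ : ι → N.ord.ToType → ι, (∀ i ∉ Z, ∀ n, q i ≤ q (φ i n)) ∧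
      (∀ i ∉ Z, ∀ j ∉ Z, ∀ n m, φ i n = φ j m → i = j ∧ n = m) := by
  classical
  let L : ι → Cardinal.{u} ×ₗ ι := fun i => toLex (q i, i)
  let _ : LinearOrder ι := IsWellOrder.linearOrder WellOrderingRel
  let r : ι → ι → Prop := fun i j => L i < L j
  have : WellFoundedLT ι := ⟨WellOrderingRel.isWellOrder.wf⟩
  have hr : IsWellOrder ι r := by
    have h0 : Function.Injective L := by
      intro a b h
      have := congrArg (fun p => (ofLex p).2) h
      exact this
    have : IsWellOrder (Cardinal.{u} ×ₗ ι) (· < ·) := inferInstance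
    let e : r ↪r ((· < ·) : Cardinal.{u} ×ₗ ι → Cardinal.{u} ×ₗ ι → Prop) :=
      ⟨⟨L, h0⟩, Iff.rfl⟩
    exact e.isWellOrder
  have hq : ∀ i j, Ordinal.typein r i ≤ Ordinal.typein r j → q i ≤ q j := by
    intro i j hij
    by_contra hc
    push Not at hc
    have : r j i := Prod.Lex.toLex_lt_toLex.2 (Or.inl hc)
    exact absurd ((Ordinal.typein_lt_typein r).2 this) (not_lt.2 hij)
  set n0 := N.ord with hn0
  have hn0pos : n0 ≠ 0 := by
    intro h
    have : N = 0 := by simpa [hn0] using h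
    rw [this] at hN
    exact absurd hN (not_le.2 aleph0_pos)
  set o := Ordinal.type r with ho
  obtain ⟨G, hG1, hG2⟩ := pairing hN
  let T := N.ord.ToType
  let b : ι → T := fun i => Ordinal.ToType.mk ⟨Ordinal.typein r i % n0, Ordinal.mod_lt _ hn0pos⟩
  let Z : Set ι := {i | n0 * (o / n0) ≤ Ordinal.typein r i}
  let φo : ι → T → Ordinal := fun i n =>
    n0 * (Ordinal.typein r i / n0) + (Ordinal.ToType.mk.symm (G (b i) n)).1
  have hlt : ∀ (_ : ι) (x : T), (Ordinal.ToType.mk.symm x).1 < n0 := fun _ x =>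
    (Ordinal.ToType.mk.symm x).2
  have hφlt : ∀ i, i ∉ Z → ∀ n, φo i n < o := by
    intro i hi n
    have h1 : Ordinal.typein r i < n0 * (o / n0) := not_le.1 hi
    have h2 : Ordinal.typein r i / n0 < o / n0 := (Ordinal.lt_mul_iff_div_lt hn0pos).1 h1
    calc φo i n < n0 * (Ordinal.typein r i / n0) + n0 := by
          simp only [φo]
          gcongr
          exact hlt i _
      _ = n0 * (Order.succ (Ordinal.typein r i / n0)) := by rw [Ordinal.mul_succ]
      _ ≤ n0 * (o / n0) := by
          gcongr
          exact Order.succ_le_of_lt h2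
      _ ≤ o := Ordinal.mul_div_le _ _
  refine ⟨Z, ?_, fun i n => if h : φo i n < o then Ordinal.enum r ⟨φo i n, h⟩ else i, ?_, ?_⟩
  · have : #Z ≤ #(Iio (Ordinal.ToType.mk ⟨o % n0, Ordinal.mod_lt _ hn0pos⟩ : T)) := by
      have key : ∀ i ∈ Z, Ordinal.typein r i % n0 < o % n0 ∧
          Ordinal.typein r i = n0 * (o / n0) + Ordinal.typein r i % n0 := by
        intro i hi
        have h1 : Ordinal.typein r i < o := Ordinal.typein_lt_type r i
        have h2 : Ordinal.typein r i / n0 = o / n0 := by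
          apply le_antisymm
          · exact Ordinal.div_le_left h1.le _
          · exact (Ordinal.mul_le_iff_le_div hn0pos).1 hi
        have h3 := Ordinal.div_add_mod (Ordinal.typein r i) n0
        rw [h2] at h3
        refine ⟨?_, h3.symm⟩
        have h4 := Ordinal.div_add_mod o n0
        have h5 : n0 * (o / n0) + Ordinal.typein r i % n0 < n0 * (o / n0) + o % n0 := by
          rw [h3, h4]; exact h1
        exact lt_of_add_lt_add_left h5
      refine mk_le_of_injective (f := fun i : Z => ⟨b i.1, ?_⟩) ?_
      · simp only [b, mem_Iio, OrderIso.lt_iff_lt]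
        exact (key i.1 i.2).1
      · rintro ⟨i, hi⟩ ⟨j, hj⟩ hij
        simp only [b, Subtype.mk.injEq, EmbeddingLike.apply_eq_iff_eq] at hij
        replace hij := congrArg Subtype.val hij
        simp only at hij
        have := (key i hi).2
        rw [hij, ← (key j hj).2] at this
        simpa using this
    exact this.trans_lt (iio_lt _ _)
  · intro i hi n
    apply hq
    simp only [dif_pos (hφlt i hi n), Ordinal.typein_enum]
    conv_lhs => rw [← Ordinal.div_add_mod (Ordinal.typein r i) n0]
    simp only [φo]
    gcongr
    have := hG1 (b i) n
    rw [← Ordinal.ToType.mk.symm.le_iff_le] at this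
    have h3 : Ordinal.ToType.mk.symm (b i) = ⟨Ordinal.typein r i % n0, Ordinal.mod_lt _ hn0pos⟩ := by
      simp [b]
    rw [h3] at this
    exact this
  · intro i hi j hj n m h
    simp only [dif_pos (hφlt i hi n), dif_pos (hφlt j hj m)] at h
    have h2 : φo i n = φo j m := by
      have := congrArg (Ordinal.typein r) h
      simpa using this
    have d1 : Ordinal.typein r i / n0 = Ordinal.typein r j / n0 := by
      have := congrArg (· / n0) h2
      simpa [φo, Ordinal.mul_add_div _ hn0pos, Ordinal.div_eq_zero_of_lt (hlt i _)] using this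
    have d2 : G (b i) n = G (b j) m := by
      simp only [φo, d1] at h2
      have := add_left_cancel h2
      exact Ordinal.ToType.mk.symm.injective (Subtype.ext this)
    obtain ⟨d3, d4⟩ := hG2 _ _ _ _ d2
    refine ⟨?_, d4⟩
    simp only [b, EmbeddingLike.apply_eq_iff_eq] at d3
    replace d3 := congrArg Subtype.val d3
    simp only at d3
    apply (Ordinal.typein_injective r)
    rw [← Ordinal.div_add_mod (Ordinal.typein r i) n0, d1, d3, Ordinal.div_add_mod]

end Sh
end

section
open Cardinal Set
namespace Sh

section top
variable {X : Type u} [TopologicalSpace X]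

/-- number of relatively open subsets of `M` -/
noncomputable def oN (M : Set X) : Cardinal.{u} := #{S : Set X | ∃ U, IsOpen U ∧ S = U ∩ M}

theorem oN_mono {M M' : Set X} (h : M ⊆ M') : oN M ≤ oN M' := by
  refine mk_le_of_surjective (f := fun S : {S : Set X | ∃ U, IsOpen U ∧ S = U ∩ M'} =>
    (⟨S.1 ∩ M, ?_⟩ : {S : Set X | ∃ U, IsOpen U ∧ S = U ∩ M})) ?_
  · obtain ⟨S, U, hU, rfl⟩ := S
    exact ⟨U, hU, by rw [inter_assoc, inter_eq_right.2 h]⟩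
  · rintro ⟨S, U, hU, rfl⟩
    exact ⟨⟨U ∩ M', U, hU, rfl⟩, Subtype.ext (by simp [inter_assoc, inter_eq_right.2 h])⟩

theorem oN_le_prod {ι : Type u} {M : Set X} (N : ι → Set X) (h : M ⊆ ⋃ i, N i) :
    oN M ≤ Cardinal.prod (fun i => oN (N i)) := by
  have e : Cardinal.prod (fun i => oN (N i)) =
    #(∀ i, {S : Set X | ∃ U, IsOpen U ∧ S = U ∩ N i}) := by simp [oN, mk_pi]
  rw [e]
  have : ∀ S : {S : Set X | ∃ U, IsOpen U ∧ S = U ∩ M}, ∃ U, IsOpen U ∧ S.1 = U ∩ M :=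
    fun S => S.2
  choose U hU hS using this
  refine mk_le_of_injective (f := fun S i => ⟨U S ∩ N i, U S, hU S, rfl⟩) ?_
  intro S S' hSS
  apply Subtype.ext
  rw [hS, hS]
  ext x
  have key : ∀ i, U S ∩ N i = U S' ∩ N i := fun i => by
    have := congrFun hSS i
    simpa using this
  constructor
  all_goals
    rintro ⟨h1, h2⟩
    obtain ⟨i, hi⟩ := mem_iUnion.1 (h h2)
    have := Set.ext_iff.1 (key i) x
    refine ⟨?_, h2⟩
    simp only [mem_inter_iff, hi, and_true] at this
    tauto

theorem oN_le_of_cover {ι : Type u} {M : Set X} (N : ι → Set X) (h : M ⊆ ⋃ i, N i)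
    {ν : Cardinal.{u}} (hν : ∀ i, oN (N i) ≤ ν) : oN M ≤ ν ^ #ι := by
  refine (oN_le_prod N h).trans ?_
  calc _ ≤ Cardinal.prod (fun _ : ι => ν) := Cardinal.prod_le_prod _ _ hν
    _ = _ := by simp

theorem oN_union (M N : Set X) : oN (M ∪ N) ≤ oN M * oN N := by
  have : ∀ S : {S : Set X | ∃ U, IsOpen U ∧ S = U ∩ (M ∪ N)}, ∃ U, IsOpen U ∧ S.1 = U ∩ (M ∪ N) :=
    fun S => S.2
  choose U hU hS using this
  rw [oN, oN, oN, mul_def]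
  refine mk_le_of_injective (f := fun S => (⟨U S ∩ M, U S, hU S, rfl⟩, ⟨U S ∩ N, U S, hU S, rfl⟩)) ?_
  intro S S' hSS
  simp only [Prod.mk.injEq, Subtype.mk.injEq] at hSS
  apply Subtype.ext
  rw [hS, hS, inter_union_distrib_left, inter_union_distrib_left, hSS.1, hSS.2]

/-- open-separated families -/
def Sep {ι : Type u} (M : ι → Set X) : Prop :=
  ∃ U : ι → Set X, (∀ i, IsOpen (U i)) ∧ (∀ i, M i ⊆ U i) ∧ ∀ i j, i ≠ j → Disjoint (M j) (U i)

theorem Sep.prod_le {ι : Type u} {M : ι → Set X} (h : Sep M) :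
    Cardinal.prod (fun i => oN (M i)) ≤ oN (⋃ i, M i) := by
  have e : Cardinal.prod (fun i => oN (M i)) =
    #(∀ i, {S : Set X | ∃ U, IsOpen U ∧ S = U ∩ M i}) := by simp [oN, mk_pi]
  rw [e]
  obtain ⟨U, hU, hMU, hd⟩ := h
  have : ∀ i (S : {S : Set X | ∃ U, IsOpen U ∧ S = U ∩ M i}), ∃ U, IsOpen U ∧ S.1 = U ∩ M i :=
    fun i S => S.2
  choose W hW hS using this
  refine mk_le_of_injective (f := fun t => (⟨(⋃ i, W i (t i) ∩ U i) ∩ ⋃ i, M i, _,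
    isOpen_iUnion fun i => (hW i (t i)).inter (hU i), rfl⟩ :
    {S : Set X | ∃ V, IsOpen V ∧ S = V ∩ ⋃ i, M i})) ?_
  have key : ∀ (t : ∀ i, {S : Set X | ∃ U, IsOpen U ∧ S = U ∩ M i}) j,
      ((⋃ i, W i (t i) ∩ U i) ∩ ⋃ i, M i) ∩ M j = (t j).1 := by
    intro t j
    rw [hS]
    ext x
    simp only [mem_inter_iff, mem_iUnion]
    constructor
    · rintro ⟨⟨⟨i, h1, h2⟩, _⟩, h3⟩
      by_cases hij : i = j
      · subst hij; exact ⟨h1, h3⟩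
      · exact absurd h2 (disjoint_left.1 (hd i j hij) h3)
    · rintro ⟨h1, h2⟩
      exact ⟨⟨⟨j, h1, hMU j h2⟩, j, h2⟩, h2⟩
  intro t t' htt
  funext j
  apply Subtype.ext
  rw [← key t j, ← key t' j]
  have := congrArg Subtype.val htt
  simp only at this
  rw [this]

theorem Sep.pow_le {ι : Type u} {M : ι → Set X} (h : Sep M) {α : Cardinal.{u}}
    (hα : ∀ i, α ≤ oN (M i)) : α ^ #ι ≤ oN (univ : Set X) := by
  calc α ^ #ι = Cardinal.prod (fun _ : ι => α) := by simp
    _ ≤ Cardinal.prod (fun i => oN (M i)) := Cardinal.prod_le_prod _ _ hα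
    _ ≤ _ := h.prod_le.trans (oN_mono (subset_univ _))

theorem Sep.comp {ι κ : Type u} {M : ι → Set X} (h : Sep M) (f : κ → ι)
    (hf : Function.Injective f) : Sep (fun k => M (f k)) := by
  obtain ⟨U, hU, hMU, hd⟩ := h
  exact ⟨fun k => U (f k), fun k => hU _, fun k => hMU _, fun i j hij => hd _ _ (hf.ne hij)⟩

theorem Sep.mono {ι : Type u} {M N : ι → Set X} (h : Sep M) (hN : ∀ i, N i ⊆ M i) : Sep N := by
  obtain ⟨U, hU, hMU, hd⟩ := h
  exact ⟨U, hU, fun k => (hN k).trans (hMU _), fun i j hij => (hd _ _ hij).mono_left (hN j)⟩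

theorem two_le_oN {M : Set X} (h : M.Nonempty) : 2 ≤ oN M := by
  rw [oN, Cardinal.two_le_iff]
  refine ⟨⟨∅, ∅, isOpen_empty, by simp⟩, ⟨M, univ, isOpen_univ, by simp⟩, ?_⟩
  intro hc
  have := congrArg Subtype.val hc
  exact h.ne_empty this.symm

theorem one_le_oN (M : Set X) : 1 ≤ oN M := by
  rw [Cardinal.one_le_iff_ne_zero, oN, mk_ne_zero_iff]
  exact ⟨⟨∅, ∅, isOpen_empty, by simp⟩⟩

theorem oN_singleton_le (x : X) : oN ({x} : Set X) ≤ 2 := by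
  have : oN ({x} : Set X) ≤ #(𝒫 ({x} : Set X)) := by
    apply mk_le_mk_of_subset
    rintro S ⟨U, _, rfl⟩
    exact inter_subset_right
  refine this.trans ?_
  rw [mk_powerset]; simp

theorem nonempty_of_oN {M : Set X} (h : 1 < oN M) : M.Nonempty := by
  by_contra hc
  rw [not_nonempty_iff_eq_empty] at hc
  subst hc
  refine absurd h (not_lt.2 ?_)
  rw [oN, Cardinal.le_one_iff_subsingleton]
  refine ⟨?_⟩
  rintro ⟨S, U, _, rfl⟩ ⟨S', U', _, rfl⟩
  simp

/-- discrete subsets -/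
def Disc (D : Set X) : Prop := ∀ x ∈ D, ∃ U, IsOpen U ∧ U ∩ D = {x}

theorem Disc.mono {D E : Set X} (h : Disc D) (hE : E ⊆ D) : Disc E := by
  intro x hx
  obtain ⟨U, hU, hUD⟩ := h x (hE hx)
  refine ⟨U, hU, ?_⟩
  ext y
  have := Set.ext_iff.1 hUD y
  simp only [mem_inter_iff, mem_singleton_iff] at *
  constructor
  · rintro ⟨h1, h2⟩; exact this.1 ⟨h1, hE h2⟩
  · rintro rfl; exact ⟨(this.2 rfl).1, hx⟩

theorem Disc.sep {D : Set X} (h : Disc D) : Sep (fun x : D => ({x.1} : Set X)) := by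
  choose! U hU hUD using h
  have k : ∀ x ∈ D, ∀ y ∈ D, y ∈ U x ↔ y = x := by
    intro x hx y hy
    have := Set.ext_iff.1 (hUD x hx) y
    simpa [hy] using this
  refine ⟨fun x => U x.1, fun x => hU _ x.2, fun x => ?_, fun i j hij => ?_⟩
  · simp [k _ x.2 _ x.2]
  · simp only [disjoint_singleton_left]
    rw [k _ i.2 _ j.2]
    exact fun h => hij (Subtype.ext h.symm)

variable (X) in
/-- cardinalities of discrete subsets -/
def KK (σ : Cardinal.{u}) : Prop := ∃ D : Set X, #D = σ ∧ Disc D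

theorem KK.mono {σ τ : Cardinal.{u}} (h : KK X τ) (hs : σ ≤ τ) : KK X σ := by
  obtain ⟨D, rfl, hD⟩ := h
  obtain ⟨E, hE, rfl⟩ := le_mk_iff_exists_subset.1 hs
  exact ⟨E, rfl, hD.mono hE⟩

theorem KK.two_pow_le {σ : Cardinal.{u}} (h : KK X σ) : 2 ^ σ ≤ oN (univ : Set X) := by
  obtain ⟨D, rfl, hD⟩ := h
  exact hD.sep.pow_le (fun x => two_le_oN (singleton_nonempty _))

theorem Sep.kk {ι : Type u} {M : ι → Set X} (h : Sep M) (hM : ∀ i, (M i).Nonempty) : KK X #ι := by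
  obtain ⟨U, hU, hMU, hd⟩ := h
  choose p hp using hM
  have hinj : Function.Injective p := by
    intro i j hij
    by_contra hc
    exact disjoint_left.1 (hd i j hc) (hp j) (hij ▸ hMU i (hp i))
  refine ⟨range p, mk_range_eq p hinj, ?_⟩
  rintro _ ⟨i, rfl⟩
  refine ⟨U i, hU i, ?_⟩
  ext y
  simp only [mem_inter_iff, mem_range, mem_singleton_iff]
  constructor
  · rintro ⟨h1, j, rfl⟩
    by_contra hc
    exact disjoint_left.1 (hd i j (fun h => hc (h ▸ rfl))) (hp j) h1
  · rintro rfl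
    exact ⟨hMU i (hp i), i, rfl⟩

variable [CompactSpace X] [T2Space X] [TotallyDisconnectedSpace X]

theorem exists_clopen {U : Set X} (hU : IsOpen U) {x : X} (hx : x ∈ U) :
    ∃ c, IsClopen c ∧ x ∈ c ∧ c ⊆ U :=
  compact_exists_isClopen_in_isOpen hU hx

end top

variable (X : Type u) [TopologicalSpace X]
/-- The contradictory context. -/
structure Ctx (mu kap kst : Cardinal.{u}) : Prop where
  sl : ∀ a < kst, 2 ^ a < kst
  al : ℵ₀ < kst
  kl : kap < kst
  ka : ℵ₀ ≤ kap
  ml : mu ≤ oN (univ : Set X)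
  lm : oN (univ : Set X) < mu ^ kap
  F1 : ∀ α < mu, ∀ ρ < kst, α ^ ρ < mu
  km : kst ≤ mu
  mx : ∀ χ, ℵ₀ ≤ χ → (∀ a < χ, 2 ^ a < χ) → χ ≤ oN (univ : Set X) → χ ≤ kst

namespace Ctx
variable {X} {mu kap kst : Cardinal.{u}} (h : Ctx X mu kap kst)
include h

theorem succ_kst {a : Cardinal.{u}} (ha : a < kst) : Order.succ a < kst :=
  (Order.succ_le_of_lt (cantor a)).trans_lt (h.sl a ha)

theorem am : ℵ₀ < mu := h.al.trans_le h.km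

theorem pow_lt {α ρ : Cardinal.{u}} (hα : α < mu) (hl : α ^ ρ ≤ oN (univ : Set X)) :
    α ^ ρ < mu := by
  rcases lt_or_ge ρ kst with hρ | hρ
  · exact h.F1 _ hα _ hρ
  · by_contra hc
    push Not at hc
    have h1 : mu ^ kap ≤ (α ^ ρ) ^ kap := power_le_power_right hc
    rw [← power_mul, mul_eq_left (h.al.le.trans hρ) (h.kl.le.trans hρ)
      (aleph0_pos.trans_le h.ka).ne'] at h1
    exact absurd h.lm (not_lt.2 (h1.trans hl))

theorem kk_lt {σ : Cardinal.{u}} (hσ : KK X σ) : 2 ^ σ < mu :=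
  h.pow_lt ((ofNat_lt_aleph0 (n := 2)).trans h.am) hσ.two_pow_le

theorem kk_lt' {σ : Cardinal.{u}} (hσ : KK X σ) : σ < mu :=
  (cantor σ).trans (h.kk_lt hσ)

theorem exists_c : ∃ (c : kap.ord.ToType → Cardinal.{u}), (∀ i, c i < mu) ∧
    mu ≤ Cardinal.sum c := by
  rcases cofDich mu kap h.am.le with ⟨ι, c, h1, h2, h3⟩ | hB
  · rw [← mk_ord_toType kap] at h1
    obtain ⟨e⟩ := Cardinal.eq.1 h1
    refine ⟨fun i => c (e.symm i), fun i => h2 _, ?_⟩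
    rw [← mk_out mu] at h3 ⊢
    have e2 : #(Σ i, (c i).out) = #(Σ i, (c (e.symm i)).out) :=
      mk_congr (Equiv.sigmaCongrLeft' e)
    simpa [mk_sigma] using h3.trans (by simpa [mk_sigma] using e2.le)
  · have := hB mu (fun α hα => (h.F1 α hα kap h.kl).le)
    rw [mul_eq_self h.am.le] at this
    exact absurd h.lm (not_lt.2 (this.trans h.ml))

theorem exists_N : ∃ ν0 < mu, ∃ ρ < kst, ∀ (a F : ρ.ord.ToType → Set X), (∀ ξ, IsClopen (a ξ)) →
    (∀ ξ, F ξ ⊆ a ξ) → (∀ ξ η, η < ξ → Disjoint (F ξ) (a η)) → ∃ ξ, oN (F ξ) ≤ ν0 := by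
  by_contra hc
  push Not at hc
  obtain ⟨c, hcm, hcs⟩ := h.exists_c
  let I := kap.ord.ToType
  have hI : #I = kap := mk_ord_toType kap
  let θ := Order.succ (2 ^ kap : Cardinal.{u})
  have hθk : θ < kst := h.succ_kst (h.sl _ h.kl)
  have h2k : ℵ₀ ≤ (2 ^ kap : Cardinal.{u}) := h.ka.trans (cantor kap).le
  have hθr : θ.IsRegular := isRegular_succ h2k
  let ρ := Order.succ (2 ^ θ : Cardinal.{u})
  have hρk : ρ < kst := h.succ_kst (h.sl _ hθk)
  let T := ρ.ord.ToType
  let d : I → Cardinal.{u} := fun i => (c i + 1) ^ kap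
  have hd : ∀ i, d i < mu := fun i => h.F1 _
    (add_lt_of_lt h.am.le (hcm i) (one_lt_aleph0.trans h.am)) _ h.kl
  let ex : Cardinal.{u} := 2 ^ (kap * ρ)
  have hex : ex < kst := h.sl _ (mul_lt_of_lt h.al.le h.kl hρk)
  have := fun i => hc (d i ^ ex) (h.F1 _ (hd i) _ hex) ρ hρk
  choose a F ha hFa hdis ho using this
  let ty : X → Set (I × T) := fun x => {p | x ∈ a p.1 p.2}
  have hF' : ∀ i ξ, ∃ t : Set (I × T), d i < oN (F i ξ ∩ ty ⁻¹' {t}) := by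
    intro i ξ
    by_contra hcon
    push Not at hcon
    have := oN_le_of_cover (M := F i ξ) (fun t => F i ξ ∩ ty ⁻¹' {t})
      (fun x hx => mem_iUnion.2 ⟨ty x, hx, rfl⟩) hcon
    have h3 : #(Set (I × T)) = ex := by
      simp [ex, I, T]
    rw [h3] at this
    exact absurd (ho i ξ) (not_lt.2 this)
  choose t ht using hF'
  let F' : I → T → Set X := fun i ξ => F i ξ ∩ ty ⁻¹' {t i ξ}
  have hhom : ∀ i ξ j η, ¬ (F' i ξ ⊆ a j η) → Disjoint (F' i ξ) (a j η) := by
    intro i ξ j η hn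
    rw [disjoint_left]
    intro x hx hxa
    apply hn
    intro y hy
    have h1 : ty x = ty y := hx.2.trans hy.2.symm
    have h2 : (j, η) ∈ ty x := hxa
    rw [h1] at h2
    exact h2
  let C := Set (I × I) × Set (I × I)
  have hC : #C = 2 ^ kap := by
    simp only [C, mk_prod, lift_id, mk_set, hI]
    rw [mul_eq_self h.ka, mul_eq_self h2k]
  have hCθ : #C < θ := by rw [hC]; exact Order.lt_succ _
  let J := I ×ₗ Bool
  have hJ : #J < θ := by
    have : #J = #I * 2 := by
      change #(I × Bool) = _
      simp
    rw [this, hI]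
    exact mul_lt_of_lt hθr.1 ((cantor kap).trans (Order.lt_succ _))
      ((ofNat_lt_aleph0 (n := 2)).trans_le hθr.1)
  obtain ⟨g, hg, cc, hcc⟩ := erdosRado (J := J) (T := T) (C := C) hθr hCθ hJ (by
      have h1 : #C + 1 ≤ 2 ^ θ := by
        have : #C + 1 < θ := add_lt_of_lt hθr.1 hCθ (one_lt_aleph0.trans_le hθr.1)
        exact this.le.trans (cantor θ).le
      calc (#C + 1) ^ θ ≤ (2 ^ θ) ^ θ := power_le_power_right h1
        _ = 2 ^ θ := by rw [← power_mul, mul_eq_self hθr.1]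
        _ < ρ := Order.lt_succ _
        _ = #T := (mk_ord_toType ρ).symm)
    (fun ξ η => ({p | F' p.2 ξ ⊆ a p.1 η}, {p | F' p.2 η ⊆ a p.1 ξ}))
  have hsep : Sep (fun i : I => F' i (g (toLex (i, true)))) := by
    refine ⟨fun i => a i (g (toLex (i, true))) \ a i (g (toLex (i, false))),
      fun i => ((ha i _).diff (ha i _)).isOpen, ?_, ?_⟩
    · intro i x hx
      refine ⟨hFa _ _ hx.1, ?_⟩
      have hlt : g (toLex (i, false)) < g (toLex (i, true)) :=
        hg (Prod.Lex.toLex_lt_toLex.2 (Or.inr ⟨rfl, by simp⟩))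
      exact disjoint_left.1 (hdis i _ _ hlt) hx.1
    · intro i j hij
      have key : F' j (g (toLex (j, true))) ⊆ a i (g (toLex (i, true))) ↔
          F' j (g (toLex (j, true))) ⊆ a i (g (toLex (i, false))) := by
        rcases lt_or_gt_of_ne hij with hlt | hlt
        · have e1 := hcc (toLex (i, true)) (toLex (j, true))
            (Prod.Lex.toLex_lt_toLex.2 (Or.inl hlt))
          have e2 := hcc (toLex (i, false)) (toLex (j, true))
            (Prod.Lex.toLex_lt_toLex.2 (Or.inl hlt))
          have := Set.ext_iff.1 (congrArg Prod.snd (e1.trans e2.symm)) (i, j)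
          exact this
        · have e1 := hcc (toLex (j, true)) (toLex (i, true))
            (Prod.Lex.toLex_lt_toLex.2 (Or.inl hlt))
          have e2 := hcc (toLex (j, true)) (toLex (i, false))
            (Prod.Lex.toLex_lt_toLex.2 (Or.inl hlt))
          have := Set.ext_iff.1 (congrArg Prod.fst (e1.trans e2.symm)) (i, j)
          exact this
      rw [disjoint_left]
      rintro x hx ⟨h1, h2⟩
      by_cases hs : F' j (g (toLex (j, true))) ⊆ a i (g (toLex (i, true)))
      · exact h2 (key.1 hs hx)
      · exact disjoint_left.1 (hhom _ _ _ _ hs) hx h1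
  have hfin : mu ^ kap ≤ oN (univ : Set X) := by
    calc mu ^ kap ≤ (Cardinal.prod (fun i => c i + 1)) ^ kap :=
          power_le_power_right (hcs.trans (sum_le_prod c))
      _ = Cardinal.prod d := (prod_power _ _).symm
      _ ≤ Cardinal.prod (fun i => oN (F' i (g (toLex (i, true))))) :=
          Cardinal.prod_le_prod _ _ (fun i => (ht i _).le)
      _ ≤ _ := hsep.prod_le.trans (oN_mono (subset_univ _))
  exact absurd h.lm (not_lt.2 hfin)

end Ctx
end Sh
end

section
open Cardinal Set
namespace Sh

theorem regular_bound {R : Cardinal.{u}} (hR : R.IsRegular) {ι : Type u} (hι : #ι < R)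
    (f : ι → R.ord.ToType) : ∃ b, ∀ i, f i < b := by
  by_contra hc
  push Not at hc
  have h1 : R ≤ Cardinal.sum (fun i => #(Set.Iic (f i))) := by
    rw [← mk_sigma]
    conv_lhs => rw [← mk_ord_toType R]
    refine mk_le_of_surjective (f := fun p : (Σ j, Set.Iic (f j)) => p.2.1) ?_
    intro b
    obtain ⟨j, hj⟩ := hc b
    exact ⟨⟨j, b, hj⟩, rfl⟩
  exact absurd h1 (not_le.2 (sum_lt_of_isRegular hR hι (fun i => iic_lt hR.1 _)))

theorem le_mk_diff {X : Type u} {A B : Set X} {c : Cardinal.{u}} (hc : ℵ₀ ≤ c) (hA : c ≤ #A)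
    (hB : #B < c) : c ≤ #(A \ B : Set X) := by
  by_contra hcon
  push Not at hcon
  have : #A ≤ #(A \ B : Set X) + #B := by
    refine (mk_le_mk_of_subset (?_ : A ⊆ (A \ B) ∪ B)).trans (mk_union_le _ _)
    intro x hx
    by_cases h : x ∈ B
    · exact Or.inr h
    · exact Or.inl ⟨hx, h⟩
  exact absurd (hA.trans this) (not_le.2 (add_lt_of_lt hc hcon hB))

theorem wf_choice {P : Type*} {G : Type*} (r : P → P → Prop) (hr : WellFounded r)
    (Φ : ∀ i : P, (∀ j, r j i → G) → G → Prop)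
    (h : ∀ i prev, ∃ x, Φ i prev x) : ∃ g : P → G, ∀ i, Φ i (fun j _ => g j) (g i) := by
  choose F hF using h
  refine ⟨hr.fix F, fun i => ?_⟩
  conv => arg 3; rw [WellFounded.fix_eq]
  exact hF _ _

theorem mk_closure_le {X : Type u} [TopologicalSpace X] [T2Space X] (S : Set X) :
    #(closure S) ≤ 2 ^ (2 ^ #S : Cardinal.{u}) := by
  have : (2 ^ (2 ^ #S : Cardinal.{u}) : Cardinal.{u}) = #(Set (Set S)) := by simp
  rw [this]
  refine mk_le_of_injective (f := fun x : closure S =>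
    {A : Set S | ∃ U, IsOpen U ∧ x.1 ∈ U ∧ A = Subtype.val ⁻¹' U}) ?_
  intro x x' hxx
  by_contra hne
  obtain ⟨U, U', hU, hU', hx, hx', hd⟩ := t2_separation (fun h => hne (Subtype.ext h))
  have h1 : (Subtype.val ⁻¹' U : Set S) ∈ {A : Set S | ∃ U, IsOpen U ∧ x.1 ∈ U ∧
    A = Subtype.val ⁻¹' U} := ⟨U, hU, hx, rfl⟩
  have h1' : (Subtype.val ⁻¹' U : Set S) ∈ {A : Set S | ∃ U, IsOpen U ∧ x'.1 ∈ U ∧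
    A = Subtype.val ⁻¹' U} := by
    simp only at hxx
    rw [← hxx]; exact h1
  obtain ⟨V, hV, hxV, hVU⟩ := h1'
  obtain ⟨w, ⟨hwV, hwU'⟩, hwS⟩ := mem_closure_iff.1 x'.2 (V ∩ U') (hV.inter hU') ⟨hxV, hx'⟩
  have h2 : (⟨w, hwS⟩ : S) ∈ (Subtype.val ⁻¹' U : Set S) := by rw [hVU]; exact hwV
  exact disjoint_left.1 hd h2 hwU'

theorem comb {X P : Type u} (v : P → Cardinal.{u}) (hv : Function.Injective v)
    (R : Cardinal.{u}) (hR : R.IsRegular) (hvr : ∀ i, (v i).IsRegular) (hRv : ∀ i, R < v i)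
    (hP : #P < R) (D : P → Set X) (c : P → X → Set X) (hD : ∀ i, #(D i) = v i)
    (hc2 : ∀ i, ∀ e ∈ D i, c i e ∩ D i = {e})
    (hcR : ∀ i j, ∀ e ∈ D i, #(c i e ∩ D j : Set X) < R) :
    ∃ E : P → Set X, (∀ i, E i ⊆ D i) ∧ (∀ i, v i ≤ #(E i)) ∧
      ∀ i j, ∀ e ∈ E i, ∀ e' ∈ E j, e' ∈ c i e → i = j ∧ e = e' := by
  classical
  let D2 : P → Set X := fun i => D i \ ⋃ j : {j // v j < v i}, ⋃ e : D j.1, (c j.1 e ∩ D i)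
  have hD2 : ∀ i, v i ≤ #(D2 i) := by
    intro i
    refine le_mk_diff (hvr i).1 (hD i).ge ?_
    rw [card_iUnion_lt_iff_forall_of_isRegular (hvr i)
      ((mk_le_of_injective Subtype.val_injective).trans_lt (hP.trans (hRv i)))]
    rintro ⟨j, hj⟩
    rw [card_iUnion_lt_iff_forall_of_isRegular (hvr i) (by rw [hD]; exact hj)]
    rintro ⟨e, he⟩
    exact (hcR j i e he).trans (hRv i)
  have hD2D : ∀ i, D2 i ⊆ D i := fun i => sdiff_subset
  have hD2c : ∀ i j, v j < v i → ∀ e ∈ D2 j, ∀ e' ∈ D2 i, e' ∉ c j e := by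
    intro i j hij e he e' he' hcon
    exact he'.2 (mem_iUnion.2 ⟨⟨j, hij⟩, mem_iUnion.2 ⟨⟨e, hD2D _ he⟩, hcon, he'.1⟩⟩)
  let T := R.ord.ToType
  obtain ⟨g, hg⟩ := wf_choice (P := P) (G := X → T) (fun j i => v j < v i)
    (InvImage.wf v wellFounded_lt)
    (fun i prev gi => ∃ r : T, ∀ t : T, v i ≤ #{e : X | e ∈ D2 i ∧ gi e = t ∧
      ∀ j (hj : v j < v i), ∀ e' ∈ D2 j, e' ∈ c i e → prev j hj e' < r}) (by
    intro i prev
    have hb : ∀ e : D2 i, ∃ b : T, ∀ j (hj : v j < v i), ∀ e' ∈ D2 j, e' ∈ c i e →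
        prev j hj e' < b := by
      intro e
      have := regular_bound hR (ι := Σ j : {j // v j < v i}, (c i e ∩ D j.1 : Set X)) (by
        rw [mk_sigma]
        refine sum_lt_of_isRegular hR
          ((mk_le_of_injective Subtype.val_injective).trans_lt hP) ?_
        intro j
        exact hcR i j.1 e (hD2D _ e.2)) (fun p => prev p.1.1 p.1.2 p.2.1)
      obtain ⟨b, hb⟩ := this
      exact ⟨b, fun j hj e' he' hce => hb ⟨⟨j, hj⟩, ⟨e', hce, hD2D _ he'⟩⟩⟩
    choose b hb using hb
    obtain ⟨r, hr⟩ := infinite_pigeonhole_card b (v i) (hD2 i) (hvr i).1 (by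
      rw [(hvr i).cof_ord]; simpa [T] using hRv i)
    have : #((v i).ord.ToType × T) ≤ #(b ⁻¹' {r}) := by
      refine le_trans ?_ hr
      simp only [mk_prod, lift_id, mk_ord_toType, T]
      rw [mul_eq_left (hvr i).1 (hRv i).le (aleph0_pos.trans_le hR.1).ne']
    obtain ⟨q⟩ := this
    have hT : Nonempty T := by
      rw [← mk_ne_zero_iff, mk_ord_toType]; exact (aleph0_pos.trans_le hR.1).ne'
    have hne : Nonempty ((v i).ord.ToType × T) := by
      have : Nonempty (v i).ord.ToType := by
        rw [← mk_ne_zero_iff, mk_ord_toType]; exact (aleph0_pos.trans_le (hvr i).1).ne'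
      infer_instance
    let q' : (v i).ord.ToType × T → X := fun p => ((q p).1.1)
    have hq' : Function.Injective q' := fun p p' h =>
      q.injective (Subtype.ext (Subtype.ext h))
    refine ⟨fun e => (Function.invFun q' e).2, r, fun t => ?_⟩
    conv_lhs => rw [← mk_ord_toType (v i)]
    refine mk_le_of_injective (f := fun w => ⟨q' (w, t), (q (w,t)).1.2, ?_, ?_⟩) ?_
    · simp only
      rw [Function.leftInverse_invFun hq']
    · intro j hj e' he' hce
      have h1 := hb (q (w, t)).1 j hj e' he' hce
      have h2 : b (q (w, t)).1 = r := (q (w, t)).2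
      rwa [h2] at h1
    · intro w w' h
      have h2 : q' (w, t) = q' (w', t) := by
        simp only [Subtype.mk.injEq] at h
        exact h
      have := hq' h2
      simpa using this)
  choose r hr using hg
  obtain ⟨rs, hrs⟩ := regular_bound hR hP r
  let E : P → Set X := fun i => {e : X | e ∈ D2 i ∧ g i e = rs ∧
      ∀ j (_ : v j < v i), ∀ e' ∈ D2 j, e' ∈ c i e → g j e' < r i}
  refine ⟨E, fun i e he => hD2D _ he.1, fun i => hr i rs, ?_⟩
  intro i j e he e' he' hce
  rcases lt_trichotomy (v i) (v j) with h | h | h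
  · exact absurd hce (hD2c j i h e he.1 e' he'.1)
  · have := hv h
    subst this
    refine ⟨rfl, ?_⟩
    have h2 : e' ∈ c i e ∩ D i := ⟨hce, hD2D _ he'.1⟩
    rw [hc2 i e (hD2D _ he.1)] at h2
    exact h2.symm
  · have := he.2.2 j h e' he'.1 hce
    rw [he'.2.1] at this
    exact absurd this (not_lt.2 (hrs i).le)

variable {X : Type u} [TopologicalSpace X]

/-- points with a small neighbourhood -/
def WL (ν : Cardinal.{u}) (L : Set X) : Set X := {x ∈ L | ∃ a, IsClopen a ∧ x ∈ a ∧ oN (L ∩ a) ≤ ν}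

/-- unsplittable -/
def Unsp (ν : Cardinal.{u}) (L : Set X) : Prop :=
  ∀ a, IsClopen a → oN (L ∩ a) ≤ ν ∨ oN (L \ a) ≤ ν

theorem Disc.le_oN {D M : Set X} (hD : Disc D) (h : D ⊆ M) : 2 ^ #D ≤ oN M := by
  have h1 := hD.sep.prod_le
  have h2 : (2 : Cardinal.{u}) ^ #D ≤ Cardinal.prod (fun i : D => oN ({i.1} : Set X)) := by
    calc (2 : Cardinal.{u}) ^ #D = Cardinal.prod (fun _ : D => (2 : Cardinal.{u})) := by simp
      _ ≤ _ := Cardinal.prod_le_prod _ _ (fun i => two_le_oN (singleton_nonempty _))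
  refine (h2.trans h1).trans (oN_mono ?_)
  intro x hx
  obtain ⟨i, hi⟩ := mem_iUnion.1 hx
  rw [mem_singleton_iff.1 hi]
  exact h i.2

section
variable [CompactSpace X]

theorem oN_le_of_WL {ν : Cardinal.{u}} (hν : ℵ₀ ≤ ν) {L F : Set X} (hF : IsClosed F)
    (hFL : F ⊆ WL ν L) : oN F ≤ ν := by
  have hFL' : F ⊆ L := fun x hx => (hFL hx).1
  have : oN (L ∩ F) ≤ ν := by
    refine IsCompact.induction_on (p := fun s => oN (L ∩ s) ≤ ν) hF.isCompact ?_ ?_ ?_ ?_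
    · refine le_trans ?_ ((one_le_aleph0).trans hν)
      by_contra hc
      obtain ⟨x, hx⟩ := nonempty_of_oN (not_le.1 hc)
      exact hx.2
    · intro s t hst ht
      exact (oN_mono (inter_subset_inter_right _ hst)).trans ht
    · intro s t hs ht
      rw [inter_union_distrib_left]
      exact (oN_union _ _).trans (mul_le_of_le hν hs ht)
    · intro x hx
      obtain ⟨-, a, ha, hxa, ho⟩ := hFL hx
      exact ⟨a, mem_nhdsWithin_of_mem_nhds (ha.isOpen.mem_nhds hxa), ho⟩
  rwa [inter_eq_right.2 hFL'] at this

variable [T2Space X] [TotallyDisconnectedSpace X]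

theorem Unsp.bad_unique {ν : Cardinal.{u}} {L : Set X} (h : Unsp ν L) {x y : X}
    (hx : x ∈ L \ WL ν L) (hy : y ∈ L \ WL ν L) : x = y := by
  by_contra hne
  obtain ⟨a, ha, hxa, hya⟩ := exists_clopen (U := {y}ᶜ) isClosed_singleton.isOpen_compl hne
  rcases h a ha with h1 | h1
  · exact hx.2 ⟨hx.1, a, ha, hxa, h1⟩
  · exact hy.2 ⟨hy.1, aᶜ, ha.compl, fun h => hya h rfl, h1⟩

end

namespace Ctx
variable {mu kap kst : Cardinal.{u}} (h : Ctx X mu kap kst)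
include h

theorem exists_leaves : ∃ ν < mu, ℵ₀ ≤ ν ∧ ∃ (Λ : Type u) (L : Λ → Set X), #Λ < kst ∧
    (∀ x, ∃ l, x ∈ L l) ∧ (∀ l, IsClosed (L l)) ∧ ∀ l, Unsp ν (L l) := by
  classical
  obtain ⟨ν0, hν0, ρ, hρ, hN⟩ := h.exists_N
  let ν := max ν0 ℵ₀
  have hνν : ν0 ≤ ν := le_max_left _ _
  refine ⟨ν, max_lt hν0 h.am, le_max_right _ _, ?_⟩
  let sp : Set X → Set X := fun K => if hK : ∃ a, IsClopen a ∧ ν < oN (K ∩ a) ∧ ν < oN (K \ a)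
    then hK.choose else ∅
  have hsp1 : ∀ K, IsClopen (sp K) := by
    intro K
    by_cases hK : ∃ a, IsClopen a ∧ ν < oN (K ∩ a) ∧ ν < oN (K \ a)
    · simp only [sp, dif_pos hK]; exact hK.choose_spec.1
    · simp only [sp, dif_neg hK]; exact isClopen_empty
  have hsp2 : ∀ K, ¬ Unsp ν K → ν < oN (K ∩ sp K) ∧ ν < oN (K \ sp K) := by
    intro K hK
    have hK : ∃ a, IsClopen a ∧ ν < oN (K ∩ a) ∧ ν < oN (K \ a) := by
      simp only [Unsp] at hK
      push Not at hK
      exact hK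
    simp only [sp, dif_pos hK]; exact hK.choose_spec.2
  let ι := ρ.ord.ToType
  let s : Set X → X → Prop := fun K z => z ∈ sp K
  let cl : X → ι → Set X := fun x i => cell s x i
  have hex : ∀ x, ∃ i, Unsp ν (cl x i) := by
    intro x
    by_contra hcon
    push Not at hcon
    let b : ι → Set X := fun i => if x ∈ sp (cl x i) then (sp (cl x i))ᶜ else sp (cl x i)
    obtain ⟨ξ, hξ⟩ := hN b (fun i => cl x i ∩ b i) (by
        intro i
        by_cases hx : x ∈ sp (cl x i)
        · simp only [b, if_pos hx]; exact (hsp1 _).compl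
        · simp only [b, if_neg hx]; exact (hsp1 _)) (fun _ => inter_subset_right) (by
        intro i j hji
        rw [disjoint_left]
        rintro z ⟨hz, -⟩ hzb
        have h1 : s (cl x j) z = s (cl x j) x := mem_cell.1 hz j hji
        have h2 : z ∈ sp (cl x j) ↔ x ∈ sp (cl x j) := Iff.of_eq h1
        by_cases hx : x ∈ sp (cl x j)
        · simp only [b, if_pos hx] at hzb; exact hzb (h2.2 hx)
        · simp only [b, if_neg hx] at hzb; exact hx (h2.1 hzb))
    have h3 := hsp2 _ (hcon ξ)
    refine absurd hξ (not_le.2 (hνν.trans_lt ?_))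
    by_cases hx : x ∈ sp (cl x ξ)
    · simp only [b, if_pos hx]; exact h3.2
    · simp only [b, if_neg hx]; exact h3.1
  refine ⟨{K : Set X // (∃ x i, K = cl x i) ∧ Unsp ν K}, fun K => K.1, ?_, ?_, ?_, fun K => K.2.2⟩
  · have : #{K : Set X // (∃ x i, K = cl x i) ∧ Unsp ν K} ≤ #(ι × (ι → Prop)) := by
      have : ∀ K : {K : Set X // (∃ x i, K = cl x i) ∧ Unsp ν K}, ∃ x i, K.1 = cl x i :=
        fun K => K.2.1
      choose x i hx using this
      refine mk_le_of_injective (f := fun K => (i K, fun j => s (cl (x K) j) (x K))) ?_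
      intro K K' hKK
      simp only [Prod.mk.injEq] at hKK
      apply Subtype.ext
      rw [hx, hx, hKK.1]
      exact cell_congr_code s (fun j _ => congrFun hKK.2 j)
    refine this.trans_lt ?_
    have e : #(ι × (ι → Prop)) = ρ * 2 ^ ρ := by simp [ι]
    rw [e]
    exact mul_lt_of_lt h.al.le hρ (h.sl _ hρ)
  · intro x
    obtain ⟨i, hi⟩ := hex x
    exact ⟨⟨cl x i, ⟨x, i, rfl⟩, hi⟩, self_mem_cell s x i⟩
  · rintro ⟨K, ⟨x, i, rfl⟩, hK⟩
    have : cl x i = ⋂ j : Iio i, {z | z ∈ sp (cl x j) ↔ x ∈ sp (cl x j)} := by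
      ext z
      simp only [cl, mem_cell, mem_iInter, s, eq_iff_iff, mem_ofPred_eq, Subtype.forall, mem_Iio]
    simp only [this]
    refine isClosed_iInter fun j => ?_
    by_cases hx : x ∈ sp (cl x j)
    · simp only [hx, iff_true]; exact (hsp1 _).isClosed
    · simp only [hx, iff_false]; exact (hsp1 _).compl.isClosed

end Ctx
end Sh
end

section
open Cardinal Set
namespace Sh
variable {X : Type u} [TopologicalSpace X]
variable [CompactSpace X] [T2Space X] [TotallyDisconnectedSpace X]

/-- boundedness of powers -/
def Bd (X : Type u) [TopologicalSpace X] (mu α : Cardinal.{u}) : Prop :=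
  ∃ ν < mu, ∀ σ, KK X σ → α ^ σ ≤ ν

theorem exists_reps {I : Type u} {α : Type*} (f : I → α) :
    ∃ S : Set I, (∀ i, ∃ j : S, f j = f i) ∧ Function.Injective (fun j : S => f j) := by
  classical
  have : ∀ a : range f, ∃ i, f i = a := fun a => a.2
  choose g hg using this
  refine ⟨range g, fun i => ⟨⟨g ⟨f i, i, rfl⟩, ⟨_, rfl⟩⟩, hg _⟩, ?_⟩
  rintro ⟨_, a, rfl⟩ ⟨_, b, rfl⟩ hab
  simp only [hg] at hab
  have := Subtype.ext hab
  subst this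
  rfl

namespace Ctx
variable {mu kap kst : Cardinal.{u}} (h : Ctx X mu kap kst)
include h

theorem bd2 : Bd X mu 2 := by
  classical
  obtain ⟨ν, hν, hν0, Λ, L, hΛ, hcov, hLc, hLu⟩ := h.exists_leaves
  by_contra hcon
  simp only [Bd] at hcon
  push Not at hcon
  have hsucc : ∀ v : Cardinal.{u}, 2 ^ v < mu → KK X (Order.succ v) := by
    intro v hv
    obtain ⟨σ, hσ, hlt⟩ := hcon _ hv
    refine hσ.mono (Order.succ_le_of_lt ?_)
    by_contra hc
    exact absurd hlt (not_lt.2 (power_le_power_left two_ne_zero (not_lt.1 hc)))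
  have hmax : ∀ v w : Cardinal.{u}, 2 ^ v < mu → 2 ^ w < mu → 2 ^ (max v w) < mu := by
    intro v w hv hw
    rcases max_choice v w with e | e <;> rw [e] <;> assumption
  have hkst : ∀ v < kst, 2 ^ v < mu := fun v hv => (h.sl v hv).trans_le h.km
  obtain ⟨R0, hR0, hR0ν⟩ := hcon ν hν
  obtain ⟨c, hc, hcs⟩ := h.exists_c
  let I := kap.ord.ToType
  let R := Order.succ (max R0 kap)
  have hRK : KK X R := hsucc _ (hmax _ _ (h.kk_lt hR0) (hkst _ h.kl))
  have hRreg : R.IsRegular := isRegular_succ (h.ka.trans (le_max_right _ _))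
  have ht : ∀ i, ∃ t, KK X t ∧ c i < 2 ^ t := fun i => hcon _ (hc i)
  choose t htK htc using ht
  let kk : Cardinal.{u} := 2 ^ (2 ^ kap : Cardinal.{u})
  have hkk : kk < kst := h.sl _ (h.sl _ h.kl)
  let w : I → Cardinal.{u} := fun i => max (t i) (max R (max #Λ kk))
  let v : I → Cardinal.{u} := fun i => Order.succ (w i)
  have hvK : ∀ i, KK X (v i) := fun i => hsucc _ (hmax _ _ (h.kk_lt (htK i))
    (hmax _ _ (h.kk_lt hRK) (hmax _ _ (hkst _ hΛ) (hkst _ hkk))))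
  have hRw : ∀ i, R ≤ w i := fun i => (le_max_left _ _).trans (le_max_right _ _)
  have htw : ∀ i, t i ≤ w i := fun i => (le_max_left _ _)
  have hΛw : ∀ i, #Λ ≤ w i := fun i => (le_max_left _ _).trans ((le_max_right _ _).trans
    (le_max_right _ _))
  have hkw : ∀ i, kk ≤ w i := fun i => (le_max_right _ _).trans ((le_max_right _ _).trans
    (le_max_right _ _))
  have hvreg : ∀ i, (v i).IsRegular := fun i => isRegular_succ (hRreg.1.trans (hRw i))
  have hwv : ∀ i, w i < v i := fun i => Order.lt_succ _
  have hR0v : ∀ i, R0 ≤ v i := fun i => (le_max_left _ _).trans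
    ((Order.le_succ _).trans ((hRw i).trans (hwv i).le))
  obtain ⟨P, hP1, hP2⟩ := exists_reps v
  have hPk : #P ≤ kap := (mk_le_of_injective Subtype.val_injective).trans (mk_ord_toType kap).le
  have hPR : #P < R := hPk.trans_lt ((le_max_right _ _).trans_lt (Order.lt_succ _))
  choose D hDc hDd using hvK
  have hleaf : ∀ i, ∃ l, v i ≤ #(D i ∩ L l : Set X) := by
    intro i
    choose lf hlf using fun x : D i => hcov x.1
    obtain ⟨l, hl⟩ := infinite_pigeonhole_card lf (v i) (hDc i).ge (hvreg i).1 (by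
      rw [(hvreg i).cof_ord]; exact (hΛw i).trans_lt (hwv i))
    refine ⟨l, hl.trans ?_⟩
    refine mk_le_of_injective (f := fun x : lf ⁻¹' {l} => ⟨x.1.1, x.1.2, ?_⟩) ?_
    · have h1 := hlf x.1
      have h2 : lf x.1 = l := x.2
      rwa [h2] at h1
    · intro x y hxy
      have h3 := congrArg (fun z : (D i ∩ L l : Set X) => z.1) hxy
      exact Subtype.ext (Subtype.ext h3)
  choose l hl using hleaf
  have hbad : ∀ i, ∃ y, y ∈ L (l i) \ WL ν (L (l i)) := by
    intro i
    by_contra hno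
    push Not at hno
    have hsub : L (l i) ⊆ WL ν (L (l i)) := by
      intro x hx
      by_contra hx2
      exact hno x ⟨hx, hx2⟩
    have h1 := oN_le_of_WL hν0 (hLc (l i)) hsub
    have h2 := ((hDd i).mono (E := D i ∩ L (l i)) inter_subset_left).le_oN (M := L (l i))
      inter_subset_right
    have h3 : (2 : Cardinal.{u}) ^ R0 ≤ 2 ^ #(D i ∩ L (l i) : Set X) :=
      power_le_power_left two_ne_zero ((hR0v i).trans (hl i))
    exact absurd (h3.trans (h2.trans h1)) (not_le.2 hR0ν)
  choose y hy using hbad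
  let Y0 := range y
  have hY0 : #(closure Y0) ≤ kk := by
    refine (mk_closure_le Y0).trans ?_
    have : #Y0 ≤ kap := mk_range_le.trans (mk_ord_toType kap).le
    exact power_le_power_left two_ne_zero (power_le_power_left two_ne_zero this)
  have hD1 : ∀ i, ∃ E ⊆ (D i ∩ L (l i)) \ closure Y0, #E = v i := fun i => 
    le_mk_iff_exists_subset.1 (le_mk_diff (hvreg i).1 (hl i)
      (hY0.trans_lt ((hkw i).trans_lt (hwv i))))
  choose D1 hD1s hD1c using hD1
  have hD1D : ∀ i, Disc (D1 i) := fun i => (hDd i).mono (fun x hx => (hD1s i hx).1.1)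
  have hce : ∀ i e, ∃ ce, IsClopen ce ∧ (e ∈ D1 i → e ∈ ce ∧ ce ∩ D1 i = {e} ∧ Disjoint ce Y0) := by
    intro i e
    by_cases he : e ∈ D1 i
    · obtain ⟨U, hU, hUD⟩ := hD1D i e he
      have heU : e ∈ U := by
        have : e ∈ U ∩ D1 i := by rw [hUD]; rfl
        exact this.1
      obtain ⟨ce, h1, h2, h3⟩ := exists_clopen
        (hU.inter (isClosed_closure (s := Y0)).isOpen_compl) ⟨heU, (hD1s i he).2⟩
      refine ⟨ce, h1, fun _ => ⟨h2, ?_, ?_⟩⟩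
      · apply subset_antisymm
        · rw [← hUD]; exact inter_subset_inter_left _ (h3.trans inter_subset_left)
        · rintro _ rfl; exact ⟨h2, he⟩
      · rw [disjoint_left]
        intro x hx hxY
        exact (h3 hx).2 (subset_closure hxY)
    · exact ⟨∅, isClopen_empty, fun h => absurd h he⟩
  choose ce hceC hce using hce
  have hcR : ∀ i j, ∀ e ∈ D1 i, #(ce i e ∩ D1 j : Set X) < R := by
    intro i j e he
    obtain ⟨-, -, h3⟩ := hce i e he
    have hW : ce i e ∩ L (l j) ⊆ WL ν (L (l j)) := by
      intro x hx
      by_contra hx2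
      have := (hLu (l j)).bad_unique ⟨hx.2, hx2⟩ (hy j)
      exact disjoint_left.1 h3 hx.1 (this ▸ mem_range_self j)
    have h1 := oN_le_of_WL hν0 ((hceC i e).isClosed.inter (hLc (l j))) hW
    have h2 := ((hD1D j).mono (E := ce i e ∩ D1 j) inter_subset_right).le_oN
      (M := ce i e ∩ L (l j)) (fun x hx => ⟨hx.1, (hD1s j hx.2).1.2⟩)
    by_contra hge
    push Not at hge
    have h4 : (2 : Cardinal.{u}) ^ R0 ≤ 2 ^ #(ce i e ∩ D1 j : Set X) :=
      power_le_power_left two_ne_zero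
        (((le_max_left _ _).trans (Order.le_succ _)).trans hge)
    exact absurd (h4.trans (h2.trans h1)) (not_le.2 hR0ν)
  obtain ⟨E, hE1, hE2, hE3⟩ := comb (fun i : P => v i) hP2 R hRreg (fun i => hvreg i)
    (fun i => (hRw i).trans_lt (hwv i)) hPR (fun i : P => D1 i) (fun i : P => ce i)
    (fun i => hD1c i) (fun i e he => (hce i e he).2.1) (fun i j e he => hcR i j e he)
  let U := ⋃ i, E i
  have hU : Disc U := by
    intro e he
    obtain ⟨i, hi⟩ := mem_iUnion.1 he
    refine ⟨ce i e, (hceC i e).isOpen, ?_⟩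
    apply subset_antisymm
    · rintro e' ⟨h1, h2⟩
      obtain ⟨j, hj⟩ := mem_iUnion.1 h2
      exact (hE3 i j e hi e' hj h1).2.symm
    · rintro _ rfl
      exact ⟨(hce i _ (hE1 i hi)).1, he⟩
  have hUm : 2 ^ #U < mu := h.kk_lt ⟨U, rfl, hU⟩
  have hvU : ∀ i, v i ≤ #U := by
    intro i
    obtain ⟨j, hj⟩ := hP1 i
    rw [← hj]
    exact (hE2 j).trans (mk_le_mk_of_subset (subset_iUnion _ _))
  have hsum : Cardinal.sum c ≤ kap * 2 ^ #U := by
    calc Cardinal.sum c ≤ Cardinal.sum (fun _ : I => (2 : Cardinal.{u}) ^ #U) := by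
          apply Cardinal.sum_le_sum
          intro i
          exact (htc i).le.trans (power_le_power_left two_ne_zero
            ((htw i).trans ((hwv i).le.trans (hvU i))))
      _ = kap * 2 ^ #U := by simp [I]
  exact absurd (hcs.trans hsum) (not_le.2 (mul_lt_of_lt h.am.le (h.kl.trans_le h.km) hUm))

end Ctx
end Sh
end

section
open Cardinal Set
namespace Sh

/-- boundedness of powers with exponents in `S` -/
def BdS (S : Cardinal.{u} → Prop) (mu α : Cardinal.{u}) : Prop :=
  ∃ ν < mu, ∀ n, S n → α ^ n ≤ ν

theorem pow_fin_le {a b n : Cardinal.{u}} (hb : ℵ₀ ≤ b) (hab : a ≤ b) (hn : n < ℵ₀) :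
    a ^ n ≤ b := by
  obtain ⟨k, rfl⟩ := lt_aleph0.1 hn
  rw [power_natCast]
  exact (pow_le_pow_left' hab k).trans (by
    exact power_nat_le (n := k) hb)

theorem BdS.of_finite {S : Cardinal.{u} → Prop} {mu α : Cardinal.{u}} (hmu : ℵ₀ < mu)
    (h2 : BdS S mu 2) (hα : α < ℵ₀) : BdS S mu α := by
  obtain ⟨ν, hν, hb⟩ := h2
  refine ⟨max ν ℵ₀, max_lt hν hmu, fun n hn => ?_⟩
  calc α ^ n ≤ (2 ^ α) ^ n := power_le_power_right (cantor α).le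
    _ = (2 ^ n) ^ α := by rw [← power_mul, mul_comm, power_mul]
    _ ≤ max ν ℵ₀ := pow_fin_le (le_max_right _ _) ((hb n hn).trans (le_max_left _ _)) hα

theorem BdS.pow_lt {S : Cardinal.{u} → Prop} {mu χ : Cardinal.{u}}
    (hS : ∀ n m, S n → S m → S (n * m))
    (hχ : ¬ BdS S mu χ) (hγ : ∀ γ < χ, BdS S mu γ) {γ n : Cardinal.{u}} (h1 : γ < χ) (hn : S n) :
    γ ^ n < χ := by
  by_contra hc
  push Not at hc
  apply hχ
  obtain ⟨ν, hν, hb⟩ := hγ γ h1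
  refine ⟨ν, hν, fun m hm => ?_⟩
  calc χ ^ m ≤ (γ ^ n) ^ m := power_le_power_right hc
    _ = γ ^ (n * m) := (power_mul).symm
    _ ≤ ν := hb _ (hS _ _ hn hm)

/-- dichotomy for a minimal bad cardinal -/
theorem BdS.exists_cof {S : Cardinal.{u} → Prop} {mu χ : Cardinal.{u}}
    (hS : ∀ n m, S n → S m → S (n * m)) (hχ0 : ℵ₀ ≤ χ) (hχm : χ < mu)
    (hχ : ¬ BdS S mu χ) (hγ : ∀ γ < χ, BdS S mu γ) : ∃ z, S z ∧
    ∃ (ι : Type u) (c : ι → Cardinal.{u}), #ι = z ∧ (∀ j, c j < χ) ∧ χ ≤ Cardinal.sum c := by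
  by_contra hcon
  push Not at hcon
  apply hχ
  refine ⟨χ, hχm, fun n hn => ?_⟩
  rcases cofDich χ n hχ0 with ⟨ι, c, h1, h2, h3⟩ | hB
  · exact absurd h3 (not_le.2 (hcon n hn ι c h1 h2))
  · have := hB χ (fun α hα => (BdS.pow_lt hS hχ hγ hα hn).le)
    rwa [mul_eq_self hχ0] at this

theorem lemX {S : Cardinal.{u} → Prop} {mu : Cardinal.{u}} (hmu : ℵ₀ < mu)
    (hS : ∀ n m, S n → S m → S (n * m)) (h2 : BdS S mu 2)
    (hp : ∀ α < mu, ∀ n, S n → α ^ n < mu) (α : Cardinal.{u}) : α < mu → BdS S mu α := by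
  induction α using WellFoundedLT.induction with | _ α ih =>
  intro hα
  by_contra hbad
  have hα0 : ℵ₀ ≤ α := by
    by_contra hc
    exact hbad (BdS.of_finite hmu h2 (not_le.1 hc))
  have hγ : ∀ γ < α, BdS S mu γ := fun γ h => ih γ h (h.trans hα)
  obtain ⟨z, hz, ι, c, h1, hc, hs⟩ := BdS.exists_cof hS hα0 hα hbad hγ
  apply hbad
  refine ⟨α ^ z, hp α hα z hz, fun n hn => ?_⟩
  rw [← h1]
  refine pow_le_of_cof hs (fun i => ?_)
  exact (BdS.pow_lt hS hbad hγ
    (add_lt_of_lt hα0 (hc i) (one_lt_aleph0.trans_le hα0)) hn).le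

variable {X : Type u} [TopologicalSpace X]

variable (X) in
/-- finite or cardinality of a discrete subset -/
def KF (σ : Cardinal.{u}) : Prop := KK X σ ∨ σ < ℵ₀

theorem KF.mul {σ τ : Cardinal.{u}} (h1 : KF X σ) (h2 : KF X τ) : KF X (σ * τ) := by
  rcases lt_or_ge σ ℵ₀ with hs | hs <;> rcases lt_or_ge τ ℵ₀ with ht | ht
  · exact Or.inr (mul_lt_aleph0 hs ht)
  · have hτ : KK X τ := h2.resolve_right (not_lt.2 ht)
    exact Or.inl (hτ.mono (mul_le_of_le ht (hs.le.trans ht) le_rfl))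
  · have hτ : KK X σ := h1.resolve_right (not_lt.2 hs)
    exact Or.inl (hτ.mono (mul_le_of_le hs le_rfl (ht.le.trans hs)))
  · have hσ : KK X σ := h1.resolve_right (not_lt.2 hs)
    have hτ : KK X τ := h2.resolve_right (not_lt.2 ht)
    rcases le_total σ τ with h | h
    · exact Or.inl (hτ.mono (mul_le_of_le ht h le_rfl))
    · exact Or.inl (hσ.mono (mul_le_of_le hs le_rfl h))

namespace Ctx
variable {mu kap kst : Cardinal.{u}} (h : Ctx X mu kap kst)

section
variable [CompactSpace X] [T2Space X] [TotallyDisconnectedSpace X]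
include h

theorem bdF2 : BdS (KF X) mu 2 := by
  obtain ⟨ν, hν, hb⟩ := h.bd2
  refine ⟨max ν ℵ₀, max_lt hν h.am, ?_⟩
  rintro n (hn | hn)
  · exact (hb n hn).trans (le_max_left _ _)
  · exact pow_fin_le (le_max_right _ _) ((ofNat_lt_aleph0 (n := 2)).le.trans (le_max_right _ _)) hn

theorem prodBound {ν1 : Cardinal.{u}} (hν1 : ν1 < mu) : ∃ ν2 < mu, ∀ (ι : Type u) (Q : ι → Set X),
    Sep Q → (∀ i, oN (Q i) ≤ ν1) → oN (⋃ i, Q i) ≤ ν2 := by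
  classical
  let A : Cardinal.{u} → Prop := fun n => ∃ α0 < mu, ∀ (Q : n.ord.ToType → Set X), Sep Q →
    ∃ i, oN (Q i) < α0
  have h2mu : (2 : Cardinal.{u}) < mu := (ofNat_lt_aleph0 (n := 2)).trans h.am
  have hA : ∃ n, A n := by
    refine ⟨oN (univ : Set X), 2, h2mu, fun Q hQ => ?_⟩
    by_contra hc
    push Not at hc
    have := hQ.pow_le hc
    rw [mk_ord_toType] at this
    exact absurd this (not_le.2 (cantor _))
  let n0 := sInf {n | A n}
  have hn0 : A n0 := csInf_mem (s := {n | A n}) hA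
  have hlt : ∀ n < n0, ∀ α < mu, ∃ Q : n.ord.ToType → Set X, Sep Q ∧ ∀ i, α ≤ oN (Q i) := by
    intro n hn α hα
    have : ¬ A n := fun hc => absurd (csInf_le' (s := {n | A n}) hc) (not_le.2 hn)
    simp only [A] at this
    push Not at this
    exact this α hα
  let N := max ℵ₀ n0
  have hN : ℵ₀ ≤ N := le_max_left _ _
  have hp : ∀ α < mu, ∀ n, n < N → α ^ n < mu := by
    intro α hα n hn
    rcases lt_or_ge n ℵ₀ with h1 | h1
    · exact h.F1 _ hα _ (h1.trans h.al)
    · obtain ⟨Q, hQ, hQα⟩ := hlt n ((lt_max_iff.1 hn).resolve_left (not_lt.2 h1)) α hα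
      have := hQ.pow_le hQα
      rw [mk_ord_toType] at this
      exact h.pow_lt hα this
  have h2 : BdS (fun n => n < N) mu 2 := by
    obtain ⟨ν, hν, hb⟩ := h.bdF2
    refine ⟨ν, hν, fun n hn => hb n ?_⟩
    rcases lt_or_ge n ℵ₀ with h1 | h1
    · exact Or.inr h1
    · obtain ⟨Q, hQ, hQα⟩ := hlt n ((lt_max_iff.1 hn).resolve_left (not_lt.2 h1)) 2 h2mu
      have := hQ.kk (fun i => nonempty_of_oN (Cardinal.one_lt_two.trans_le (hQα i)))
      rw [mk_ord_toType] at this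
      exact Or.inl this
  obtain ⟨ν', hν', hb⟩ := lemX (S := fun n => n < N) h.am (fun n m hn hm => mul_lt_of_lt hN hn hm) h2 hp ν1 hν1
  obtain ⟨α0, hα0, hα⟩ := hn0
  refine ⟨ν' * α0, mul_lt_of_lt h.am.le hν' hα0, fun ι Q hQ hQν => ?_⟩
  obtain ⟨Z, hZ, φ, hφ1, hφ2⟩ := splitting (fun i => oN (Q i)) hN
  have hu : (⋃ i, Q i) ⊆ (⋃ i : Z, Q i) ∪ ⋃ i : (Zᶜ : Set ι), Q i := by
    intro x hx
    obtain ⟨i, hi⟩ := mem_iUnion.1 hx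
    by_cases hiZ : i ∈ Z
    · exact Or.inl (mem_iUnion.2 ⟨⟨i, hiZ⟩, hi⟩)
    · exact Or.inr (mem_iUnion.2 ⟨⟨i, hiZ⟩, hi⟩)
  refine (oN_mono hu).trans ((oN_union _ _).trans (mul_le_mul' ?_ ?_))
  · exact (oN_le_of_cover (fun i : Z => Q i) subset_rfl (fun i => hQν i)).trans (hb _ hZ)
  · let pc : N.ord.ToType → Set X := fun n => ⋃ i : (Zᶜ : Set ι), Q (φ i n)
    have hpc : Sep pc := by
      obtain ⟨U, hU, hMU, hd⟩ := hQ
      refine ⟨fun n => ⋃ i : (Zᶜ : Set ι), U (φ i n), fun n => isOpen_iUnion fun i => hU _,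
        fun n => iUnion_mono fun i => hMU _, fun n m hnm => ?_⟩
      simp only [pc, disjoint_iUnion_left, disjoint_iUnion_right]
      intro i j
      exact hd _ _ (fun hc => hnm (hφ2 _ i.2 _ j.2 _ _ hc).2)
    have hpo : ∀ n, Cardinal.prod (fun i : (Zᶜ : Set ι) => oN (Q i)) ≤ oN (pc n) := by
      intro n
      refine le_trans (Cardinal.prod_le_prod _ _ (fun i => hφ1 i.1 i.2 n)) ?_
      exact (hQ.comp (fun i : (Zᶜ : Set ι) => φ i n)
        (fun i j hij => Subtype.ext (hφ2 _ i.2 _ j.2 _ _ hij).1)).prod_le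
    have : #n0.ord.ToType ≤ #N.ord.ToType := by simp [N]
    obtain ⟨e⟩ := this
    obtain ⟨i, hi⟩ := hα _ (hpc.comp e e.injective)
    exact (oN_le_prod _ subset_rfl).trans ((hpo _).trans hi.le)

end
end Ctx
end Sh
end

section
open Cardinal Set
namespace Sh

section
variable {X : Type u} [TopologicalSpace X]

/-- `b` contains `n` pairwise disjoint nonempty clopen sets -/
def Cel (b : Set X) (n : Cardinal.{u}) : Prop :=
  ∃ (ι : Type u) (U : ι → Set X), #ι = n ∧ (∀ i, IsClopen (U i)) ∧ (∀ i, (U i).Nonempty) ∧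
    (∀ i, U i ⊆ b) ∧ ∀ i j, i ≠ j → Disjoint (U i) (U j)

theorem Cel.mono {b b' : Set X} {n m : Cardinal.{u}} (h : Cel b n) (hb : b ⊆ b') (hm : m ≤ n) :
    Cel b' m := by
  obtain ⟨ι, U, rfl, h1, h2, h3, h4⟩ := h
  rw [← mk_out m] at hm
  obtain ⟨e⟩ := hm
  exact ⟨m.out, U ∘ e, by simp, fun i => h1 _, fun i => h2 _, fun i => (h3 _).trans hb,
    fun i j hij => h4 _ _ (fun hc => hij (e.injective hc))⟩

theorem Cel.le {b : Set X} {n : Cardinal.{u}} (h : Cel b n) : n ≤ #X := by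
  obtain ⟨ι, U, rfl, h1, h2, h3, h4⟩ := h
  choose p hp using h2
  refine mk_le_of_injective (f := p) (fun i j hij => ?_)
  by_contra hc
  exact disjoint_left.1 (h4 i j hc) (hp i) (hij ▸ hp j)

theorem Cel.kk {b : Set X} {n : Cardinal.{u}} (h : Cel b n) : KK X n := by
  obtain ⟨ι, U, rfl, h1, h2, h3, h4⟩ := h
  exact Sep.kk (M := U) ⟨U, fun i => (h1 i).isOpen, fun i => subset_rfl,
    fun i j hij => h4 j i hij.symm⟩ h2

theorem Cel.sum {ι : Type u} {U : ι → Set X} {b : Set X} (hb : ∀ i, U i ⊆ b)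
    (hd : ∀ i j, i ≠ j → Disjoint (U i) (U j)) {f : ι → Cardinal.{u}} (h : ∀ i, Cel (U i) (f i)) :
    Cel b (Cardinal.sum f) := by
  choose K V h0 h1 h2 h3 h4 using h
  refine ⟨Σ i, K i, fun p => V p.1 p.2, ?_, fun p => h1 _ _, fun p => h2 _ _,
    fun p => (h3 _ _).trans (hb _), ?_⟩
  · rw [mk_sigma]; congr; funext i; exact h0 i
  · rintro ⟨i, k⟩ ⟨j, l⟩ hne
    by_cases hij : i = j
    · subst hij
      exact h4 i k l (fun hc => hne (by rw [hc]))
    · exact (hd i j hij).mono (h3 _ _) (h3 _ _)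

/-- least cardinal with no cellular family -/
noncomputable def rr (b : Set X) : Cardinal.{u} := sInf {n | ¬ Cel b n}

theorem lt_rr {b : Set X} {n : Cardinal.{u}} : n < rr b ↔ Cel b n := by
  constructor
  · intro h
    by_contra hc
    exact absurd (csInf_le' (s := {n | ¬ Cel b n}) hc) (not_le.2 h)
  · intro h
    by_contra hc
    have hne : {n | ¬ Cel b n}.Nonempty := ⟨Order.succ #X, fun hc =>
      absurd hc.le (not_le.2 (Order.lt_succ _))⟩
    exact csInf_mem hne (h.mono subset_rfl (not_lt.1 hc))

theorem rr_mono {b b' : Set X} (h : b ⊆ b') : rr b ≤ rr b' := by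
  by_contra hc
  exact absurd ((lt_rr.1 (not_le.1 hc)).mono h le_rfl |> lt_rr.2) (lt_irrefl _)

/-- homogeneous clopen sets -/
def Hmg (b : Set X) : Prop :=
  IsClopen b ∧ b.Nonempty ∧ ∀ c, IsClopen c → c.Nonempty → c ⊆ b → rr b ≤ rr c

theorem exists_hmg {b : Set X} (hb : IsClopen b) (hn : b.Nonempty) : ∃ c ⊆ b, Hmg c := by
  let S : Set Cardinal.{u} := {n | ∃ c, IsClopen c ∧ c.Nonempty ∧ c ⊆ b ∧ rr c = n}
  have hS : S.Nonempty := ⟨rr b, b, hb, hn, subset_rfl, rfl⟩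
  obtain ⟨c, h1, h2, h3, h4⟩ := csInf_mem hS
  exact ⟨c, h3, h1, h2, fun d hd1 hd2 hd3 => h4.trans_le
    (csInf_le' ⟨d, hd1, hd2, hd3.trans h3, rfl⟩)⟩

/-- maximal disjoint subfamilies -/
theorem exists_max_disj (A : Set (Set X)) : ∃ H ⊆ A, H.PairwiseDisjoint id ∧
    ∀ a ∈ A, a.Nonempty → ∃ h ∈ H, (h ∩ a).Nonempty := by
  obtain ⟨H, hH⟩ := zorn_subset {H : Set (Set X) | H ⊆ A ∧ H.PairwiseDisjoint id} (by
    intro c hc hch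
    refine ⟨⋃₀ c, ⟨sUnion_subset fun s hs => (hc hs).1, ?_⟩, fun s hs => subset_sUnion_of_mem hs⟩
    exact (pairwiseDisjoint_sUnion hch.directedOn).2 (fun s hs => (hc hs).2))
  refine ⟨H, hH.prop.1, hH.prop.2, fun a ha hne => ?_⟩
  by_contra hcon
  push Not at hcon
  have h1 : insert a H ∈ {H : Set (Set X) | H ⊆ A ∧ H.PairwiseDisjoint id} := by
    refine ⟨insert_subset ha hH.prop.1, hH.prop.2.insert ?_⟩
    intro h hh _
    exact (disjoint_iff_inter_eq_empty.2 (hcon h hh)).symm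
  have h2 : a ∈ H := hH.le_of_ge h1 (subset_insert _ _) (mem_insert _ _)
  have := hcon a h2
  rw [inter_self] at this
  exact hne.ne_empty this

/-- Erdos-Tarski -/
theorem erdosTarski (hr : ℵ₀ < rr (univ : Set X)) {ι : Type u} (hι : #ι < rr (univ : Set X))
    (f : ι → Cardinal.{u}) (hf : ∀ j, f j < rr (univ : Set X)) :
    ∃ σ < rr (univ : Set X), ∀ j, f j ≤ σ := by
  classical
  obtain ⟨H, hHA, hHd, hHm⟩ := exists_max_disj {c : Set X | Hmg c}
  have hdis : ∀ i j : H, i ≠ j → Disjoint (i.1) (j.1) := fun i j hij =>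
    hHd i.2 j.2 (fun hc => hij (Subtype.ext hc))
  have hmeet : ∀ b : Set X, IsClopen b → b.Nonempty → ∃ h : H, (h.1 ∩ b).Nonempty := by
    intro b hb hn
    obtain ⟨c, hcb, hc⟩ := exists_hmg hb hn
    obtain ⟨h, hh, hhc⟩ := hHm c hc hc.2.1
    exact ⟨⟨h, hh⟩, hhc.mono (inter_subset_inter_right _ hcb)⟩
  have hHr : #H < rr (univ : Set X) := lt_rr.2
    ⟨H, fun h => h.1, rfl, fun h => (hHA h.2).1, fun h => (hHA h.2).2.1, fun h => subset_univ _, hdis⟩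
  by_cases h1 : ∃ h : H, rr (univ : Set X) ≤ rr h.1
  · obtain ⟨h, hh⟩ := h1
    obtain ⟨K, U, hK, hU1, hU2, hU3, hU4⟩ := lt_rr.1 (hι.trans_le hh)
    obtain ⟨e⟩ := Cardinal.eq.1 hK
    refine ⟨Cardinal.sum f, lt_rr.2 (Cel.sum (U := fun j => U (e.symm j)) (fun _ => subset_univ _)
      (fun i j hij => hU4 _ _ (fun hc => hij (e.symm.injective hc))) (fun j => lt_rr.1 ?_)),
      fun j => le_sum f j⟩
    exact (hf j).trans_le (hh.trans ((hHA h.2).2.2 _ (hU1 _) (hU2 _) (hU3 _)))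
  push Not at h1
  by_cases h2 : ∃ t < rr (univ : Set X), ∀ h : H, rr h.1 ≤ t
  · obtain ⟨t, ht, hb⟩ := h2
    refine ⟨#H * t, mul_lt_of_lt hr.le hHr ht, fun j => ?_⟩
    obtain ⟨K, U, hK, hU1, hU2, hU3, hU4⟩ := lt_rr.1 (hf j)
    choose g hg using fun k => hmeet (U k) (hU1 k) (hU2 k)
    rw [← hK]
    refine mk_le_mk_mul_of_mk_preimage_le g (fun h => le_trans ?_ (hb h))
    refine (lt_rr.2 ⟨g ⁻¹' {h}, fun k => h.1 ∩ U k.1, rfl, fun k => (hHA h.2).1.inter (hU1 _),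
      fun k => ?_, fun k => inter_subset_left, fun k l hkl => ?_⟩).le
    · have := hg k.1
      rwa [show g k.1 = h from k.2] at this
    · exact (hU4 _ _ (fun hc => hkl (Subtype.ext hc))).mono inter_subset_right inter_subset_right
  push Not at h2
  exfalso
  have hs : ∀ h : H, ∃ s < rr h.1, ∀ g : H, rr g.1 < rr h.1 →
      (∀ k : H, rr g.1 < rr k.1 → rr h.1 ≤ rr k.1) → rr g.1 ≤ s := by
    intro h
    by_cases hex : ∃ g : H, rr g.1 < rr h.1 ∧ (∀ k : H, rr g.1 < rr k.1 → rr h.1 ≤ rr k.1)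
    · obtain ⟨g, hg1, hg2⟩ := hex
      refine ⟨rr g.1, hg1, fun g' h1 h2 => ?_⟩
      by_contra hc
      exact absurd (hg2 g' (not_le.1 hc)) (not_le.2 h1)
    · push Not at hex
      refine ⟨0, lt_rr.2 ⟨PEmpty, PEmpty.elim, by simp, by simp, by simp, by simp, by simp⟩, ?_⟩
      intro g hg1 hg2
      obtain ⟨k, hk1, hk2⟩ := hex g hg1
      exact absurd (hg2 k hk1) (not_le.2 hk2)
  choose s hs1 hs2 using hs
  have hsum : Cardinal.sum s < rr (univ : Set X) := lt_rr.2
    (Cel.sum (U := fun h : H => h.1) (fun _ => subset_univ _) hdis (fun h => lt_rr.1 (hs1 h)))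
  obtain ⟨g, hg⟩ := h2 _ hsum
  let S : Set Cardinal.{u} := {n | ∃ k : H, rr g.1 < rr k.1 ∧ rr k.1 = n}
  have hS : S.Nonempty := by
    obtain ⟨k, hk⟩ := h2 _ (h1 g)
    exact ⟨_, k, hk, rfl⟩
  obtain ⟨k, hk1, hk2⟩ := csInf_mem hS
  have := hs2 k g hk1 (fun l hl => hk2.trans_le (csInf_le' ⟨l, hl, rfl⟩))
  exact absurd (this.trans (le_sum s k)) (not_le.2 hg)

end
end Sh
end

section
open Cardinal Set
namespace Sh

section
variable {X : Type u} [TopologicalSpace X]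
variable [CompactSpace X] [T2Space X] [TotallyDisconnectedSpace X]

theorem mk_finset_iio {β : Cardinal.{u}} (hβ : ℵ₀ ≤ β) (i : (Order.succ β).ord.ToType) :
    #(Finset (Iio i)) ≤ β := by
  have h1 : #(Iio i) ≤ β := Order.lt_succ_iff.1 (iio_lt _ i)
  rcases lt_or_ge #(Iio i) ℵ₀ with h | h
  · have : Finite (Iio i) := lt_aleph0_iff_finite.1 h
    exact (lt_aleph0_of_finite _).le.trans hβ
  · have : Infinite (Iio i) := infinite_iff.2 h
    rw [mk_finset_of_infinite]; exact h1

/-- local pi-bases -/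
theorem exists_pibase {β : Cardinal.{u}} (hβ : ℵ₀ ≤ β) (hK : ∀ σ, KK X σ → σ ≤ β) (x : X) :
    ∃ P : β.ord.ToType → Set X, (∀ b, IsClopen (P b) ∧ (P b).Nonempty) ∧
      ∀ U, IsOpen U → x ∈ U → ∃ b, P b ⊆ U := by
  classical
  by_contra hcon
  push Not at hcon
  -- version for arbitrary index types
  have hidx : ∀ (K : Type u), #K ≤ β → ∀ P : K → Set X, (∀ b, IsClopen (P b)) →
      ∃ U, IsClopen U ∧ x ∈ U ∧ ∀ b, (P b).Nonempty → ¬ P b ⊆ U := by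
    intro K hKβ P hP
    rw [← mk_ord_toType β] at hKβ
    obtain ⟨e⟩ := hKβ
    let P' : β.ord.ToType → Set X := fun b => if h : ∃ k, e k = b ∧ (P k).Nonempty then P h.choose
      else univ
    obtain ⟨U, hU, hxU, hb⟩ := hcon P' (by
      intro b
      by_cases h : ∃ k, e k = b ∧ (P k).Nonempty
      · simp only [P', dif_pos h]; exact ⟨hP _, h.choose_spec.2⟩
      · simp only [P', dif_neg h]; exact ⟨isClopen_univ, ⟨x, trivial⟩⟩)
    obtain ⟨c, hc, hxc, hcU⟩ := exists_clopen hU hxU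
    refine ⟨c, hc, hxc, fun k hk hkc => hb (e k) ?_⟩
    have h : ∃ k', e k' = e k ∧ (P k').Nonempty := ⟨k, rfl, hk⟩
    simp only [P', dif_pos h]
    have : h.choose = k := e.injective h.choose_spec.1
    rw [this]; exact hkc.trans hcU
  let θ := (Order.succ β).ord.ToType
  obtain ⟨a, ha⟩ := wf_choice (P := θ) (G := {c : Set X // IsClopen c}) (· < ·) wellFounded_lt
    (fun i prev y => x ∈ y.1 ∧ ∀ S T : Finset (Iio i),
      ((⋂ j ∈ S, (prev j.1 j.2).1) ∩ ⋂ j ∈ T, (prev j.1 j.2).1ᶜ).Nonempty →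
      ¬ ((⋂ j ∈ S, (prev j.1 j.2).1) ∩ ⋂ j ∈ T, (prev j.1 j.2).1ᶜ) ⊆ y.1) (by
    intro i prev
    obtain ⟨U, hU, hxU, hb⟩ := hidx (Finset (Iio i) × Finset (Iio i)) (by
      rw [mk_prod]; simp only [lift_id]
      exact mul_le_of_le hβ (mk_finset_iio hβ i) (mk_finset_iio hβ i))
      (fun ST => (⋂ j ∈ ST.1, (prev j.1 j.2).1) ∩ ⋂ j ∈ ST.2, (prev j.1 j.2).1ᶜ) (by
      rintro ⟨S, T⟩
      exact (isClopen_biInter_finset fun j _ => (prev j.1 j.2).2).inter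
        (isClopen_biInter_finset fun j _ => (prev j.1 j.2).2.compl))
    exact ⟨⟨U, hU⟩, hxU, fun S T => hb (S, T)⟩)
  have hxa : ∀ i, x ∈ (a i).1 := fun i => (ha i).1
  have hfin : ∀ (i : θ) (S : Finset θ), (∀ j ∈ S, j < i) → ∀ T : Finset θ, (∀ j ∈ T, i ≤ j) →
      ((⋂ j ∈ S, (a j).1) ∩ ⋂ j ∈ T, (a j).1ᶜ).Nonempty := by
    intro i S hS T
    induction T using Finset.induction_on_max with
    | empty => intro _; exact ⟨x, by simp [hxa]⟩
    | insert t T htT ih =>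
      intro hT
      have h1 := ih (fun j hj => hT j (Finset.mem_insert_of_mem hj))
      have hit : i ≤ t := hT t (Finset.mem_insert_self _ _)
      have e1 : (⋂ j ∈ S, (a j).1) = ⋂ j ∈ S.subtype (· ∈ Iio t), (a j.1).1 := by
        ext y
        simp only [mem_iInter, Finset.mem_subtype, Subtype.forall]
        exact ⟨fun h j _ hj => h j hj, fun h j hj => h j ((hS j hj).trans_le hit) hj⟩
      have e2 : (⋂ j ∈ T, (a j).1ᶜ) = ⋂ j ∈ T.subtype (· ∈ Iio t), (a j.1).1ᶜ := by
        ext y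
        simp only [mem_iInter, Finset.mem_subtype, Subtype.forall]
        exact ⟨fun h j _ hj => h j hj, fun h j hj => h j (htT j hj) hj⟩
      rw [e1, e2] at h1
      have h2 := (ha t).2 _ _ h1
      rw [← e1, ← e2] at h2
      obtain ⟨y, hy, hyt⟩ := not_subset.1 h2
      refine ⟨y, hy.1, ?_⟩
      simp only [mem_iInter, Finset.mem_insert]
      rintro j (rfl | hj)
      · exact hyt
      · exact mem_iInter₂.1 hy.2 j hj
  have hp : ∀ i : θ, ∃ p : X, ∀ j, (p ∈ (a j).1 ↔ j < i) := by
    intro i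
    let Z : θ → Set X := fun j => if j < i then (a j).1 else (a j).1ᶜ
    have hZ : ∀ j, IsClopen (Z j) := by
      intro j
      by_cases h : j < i
      · simp only [Z, if_pos h]; exact (a j).2
      · simp only [Z, if_neg h]; exact (a j).2.compl
    have := CompactSpace.iInter_nonempty (t := Z) (fun j => (hZ j).isClosed) (by
      intro F
      obtain ⟨y, hy1, hy2⟩ := hfin i (F.filter (· < i)) (fun j hj => (Finset.mem_filter.1 hj).2)
        (F.filter (fun j => ¬ j < i)) (fun j hj => not_lt.1 (Finset.mem_filter.1 hj).2)
      refine ⟨y, mem_iInter₂.2 fun j hj => ?_⟩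
      by_cases h : j < i
      · simp only [Z, if_pos h]; exact mem_iInter₂.1 hy1 j (Finset.mem_filter.2 ⟨hj, h⟩)
      · simp only [Z, if_neg h]; exact mem_iInter₂.1 hy2 j (Finset.mem_filter.2 ⟨hj, h⟩))
    obtain ⟨p, hp⟩ := this
    refine ⟨p, fun j => ?_⟩
    have := mem_iInter.1 hp j
    by_cases h : j < i
    · simp only [Z, if_pos h] at this; simp [h, this]
    · simp only [Z, if_neg h] at this; simpa [h] using this
  choose p hp using hp
  have hθ : ℵ₀ ≤ Order.succ β := hβ.trans (Order.le_succ _)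
  have hmax : ∀ i : θ, ∃ j : θ, i < j ∧ ∀ k, i < k → j ≤ k := by
    intro i
    have hne : (Ioi i).Nonempty := by
      by_contra hc
      have : Iic i = (Set.univ : Set θ) := by
        ext j
        refine ⟨fun _ => trivial, fun _ => ?_⟩
        by_contra h
        exact hc ⟨j, show i < j from lt_of_not_ge h⟩
      have h2 := iic_lt hθ i
      rw [this, mk_univ, mk_ord_toType] at h2
      exact lt_irrefl _ h2
    exact ⟨wellFounded_lt.min _ hne, wellFounded_lt.min_mem _ hne,
      fun k hk => WellFounded.min_le wellFounded_lt hk⟩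
  choose sc hsc1 hsc2 using hmax
  have hsep : Sep (fun i : θ => ({p (sc i)} : Set X)) := by
    refine ⟨fun i => (a i).1 \ (a (sc i)).1, fun i => ((a i).2.diff (a (sc i)).2).isOpen, ?_, ?_⟩
    · rintro i _ rfl
      exact ⟨(hp _ _).2 (hsc1 i), fun hc => lt_irrefl _ ((hp _ _).1 hc)⟩
    · intro i j hij
      rw [disjoint_singleton_left]
      rintro ⟨h1, h2⟩
      rw [hp] at h1 h2
      -- i < sc j, sc j ≤ sc i
      have hscle := not_lt.1 h2
      rcases lt_trichotomy i j with h | h | h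
      · exact absurd ((hsc2 i j h).trans_lt (hsc1 j)) (not_lt.2 hscle)
      · exact hij h
      · exact absurd (hsc2 j i h) (not_le.2 h1)
  have := hK _ (hsep.kk (fun i => singleton_nonempty _))
  rw [mk_ord_toType] at this
  exact absurd this (not_le.2 (Order.lt_succ _))

end
end Sh
end

section
open Cardinal Set
namespace Sh

theorem exists_iio_eq {r σ : Cardinal.{u}} (h : σ < r) : ∃ i : r.ord.ToType, #(Iio i) = σ := by
  have h1 : σ.ord < Ordinal.type (α := r.ord.ToType) (· < ·) := by
    rw [Ordinal.type_toType]; exact ord_lt_ord.2 h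
  refine ⟨Ordinal.enum (α := r.ord.ToType) (· < ·) ⟨σ.ord, h1⟩, ?_⟩
  have h2 := Ordinal.typein_enum (α := r.ord.ToType) (· < ·) h1
  have h3 := congrArg Ordinal.card h2
  rw [card_ord] at h3
  exact h3

theorem exists_range_iio {A : Type u} {r : Cardinal.{u}} (M : Set A) (h : #M < r) :
    ∃ (i : r.ord.ToType) (g : Iio i → A), range g = M := by
  obtain ⟨i, hi⟩ := exists_iio_eq h
  obtain ⟨e⟩ := Cardinal.eq.1 hi
  refine ⟨i, fun j => (e j).1, ?_⟩
  ext x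
  constructor
  · rintro ⟨j, rfl⟩; exact (e j).2
  · intro hx; exact ⟨e.symm ⟨x, hx⟩, by simp⟩

theorem mk_small_subsets {A : Type u} {r Γ : Cardinal.{u}} (hA : #A ≤ Γ) (hr : ℵ₀ ≤ r)
    (hrΓ : r ≤ Γ) (hΓ : ∀ σ < r, Γ ^ σ ≤ Γ) : #{M : Set A | #M < r} ≤ Γ := by
  have h1 : #{M : Set A | #M < r} ≤ #(Σ i : r.ord.ToType, (Iio i → A)) := by
    choose i g hg using fun M : {M : Set A | #M < r} => exists_range_iio M.1 M.2
    refine mk_le_of_injective (f := fun M => ⟨i M, g M⟩) ?_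
    intro M N h
    have : ∀ p q : (Σ i : r.ord.ToType, (Iio i → A)), p = q → range p.2 = range q.2 := by
      rintro p q rfl; rfl
    have := this _ _ h
    simp only [hg] at this
    exact Subtype.ext this
  refine h1.trans ?_
  rw [mk_sigma]
  calc Cardinal.sum (fun i : r.ord.ToType => #(Iio i → A))
      ≤ Cardinal.sum (fun i : r.ord.ToType => Γ) := by
        refine sum_le_sum _ _ fun i => ?_
        rw [← power_def]
        exact (power_le_power_right hA).trans (hΓ _ (iio_lt _ i))
    _ = r * Γ := by simp
    _ ≤ Γ := mul_le_of_le (hr.trans hrΓ) hrΓ le_rfl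

section
variable {X : Type u} [TopologicalSpace X]
variable [CompactSpace X] [T2Space X] [TotallyDisconnectedSpace X]

theorem clopen_count {β r Γ : Cardinal.{u}} (hβ : ℵ₀ ≤ β) (hK : ∀ σ, KK X σ → σ ≤ β)
    (hr : ℵ₀ ≤ r) (hcel : ∀ n, Cel (univ : Set X) n → n < r) (hrΓ : r ≤ Γ) (hβΓ : β ≤ Γ)
    (hΓ : ∀ σ < r, Γ ^ σ ≤ Γ) : #{c : Set X // IsClopen c} ≤ Γ := by
  classical
  have hΓ0 : ℵ₀ ≤ Γ := hr.trans hrΓ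
  rcases isEmpty_or_nonempty X with hX | hX
  · refine (mk_le_one_iff_set_subsingleton.2 ?_).trans (one_le_aleph0.trans hΓ0)
    intro a _ b _
    exact Subsingleton.elim a b
  choose P hP1 hP2 using exists_pibase (X := X) hβ hK
  let F : Set (Set X) → β.ord.ToType → Set X := fun 𝒰 b =>
    if h : ∃ x, x ∉ closure (⋃₀ 𝒰) then P h.choose b else Set.univ
  have hF : ∀ 𝒰 b, IsClopen (F 𝒰 b) ∧ (F 𝒰 b).Nonempty := by
    intro 𝒰 b
    by_cases h : ∃ x, x ∉ closure (⋃₀ 𝒰)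
    · simp only [F, dif_pos h]; exact hP1 _ _
    · simp only [F, dif_neg h]; exact ⟨isClopen_univ, univ_nonempty⟩
  let ar : r.ord.ToType × β.ord.ToType → Type u := fun p => Iio p.1
  let ev : WType ar → Set X := WType.elim (Set X) (fun p => F (range p.2) p.1.2)
  have hev : ∀ p g, ev (WType.mk p g) = F (range fun k => ev (g k)) p.2 := fun p g => rfl
  let E : Set (Set X) := range ev
  have hE1 : ∀ e ∈ E, IsClopen e ∧ e.Nonempty := by
    rintro _ ⟨⟨p, g⟩, rfl⟩
    rw [hev]; exact hF _ _
  have hEc : #E ≤ Γ := by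
    refine mk_range_le.trans (WType.cardinalMk_le_of_le ?_)
    calc Cardinal.sum (fun a : r.ord.ToType × β.ord.ToType => Γ ^ #(ar a))
        ≤ Cardinal.sum (fun a : r.ord.ToType × β.ord.ToType => Γ) :=
          sum_le_sum _ _ fun a => hΓ _ (iio_lt _ a.1)
      _ = r * β * Γ := by simp
      _ ≤ Γ := mul_le_of_le hΓ0 (mul_le_of_le hΓ0 hrΓ hβΓ) le_rfl
  have hcard : ∀ 𝒰 ⊆ E, 𝒰.PairwiseDisjoint id → #𝒰 < r := by
    intro 𝒰 h1 h2
    refine hcel _ ⟨𝒰, fun e => e.1, rfl, fun e => (hE1 _ (h1 e.2)).1, fun e => (hE1 _ (h1 e.2)).2,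
      fun _ => subset_univ _, fun i j hij => h2 i.2 j.2 (fun hc => hij (Subtype.ext hc))⟩
  have hclo : ∀ 𝒰 ⊆ E, 𝒰.PairwiseDisjoint id → (∃ x, x ∉ closure (⋃₀ 𝒰)) →
      ∃ x, x ∉ closure (⋃₀ 𝒰) ∧ ∀ b, P x b ∈ E := by
    intro 𝒰 h1 h2 hx
    refine ⟨hx.choose, hx.choose_spec, fun b => ?_⟩
    obtain ⟨i, g, hg⟩ := exists_range_iio (r := r) 𝒰 (hcard 𝒰 h1 h2)
    have : ∀ k, ∃ w, ev w = g k := fun k => h1 (hg ▸ mem_range_self k)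
    choose w hw using this
    refine ⟨WType.mk (i, b) w, ?_⟩
    rw [hev]
    simp only [hw]
    have hg' : range (fun k => g k) = 𝒰 := hg
    rw [show (range fun k : ar (i, b) => g k) = 𝒰 from hg]
    simp only [F, dif_pos hx]
  have hpi : ∀ v : Set X, IsClopen v → v.Nonempty → ∃ e ∈ E, e ⊆ v := by
    intro v hv hne
    by_contra hcon
    push Not at hcon
    obtain ⟨𝒰, hU1, hU2, hU3⟩ := exists_max_disj {e ∈ E | Disjoint e v}
    have hUv : Disjoint (closure (⋃₀ 𝒰)) v := by
      have : closure (⋃₀ 𝒰) ⊆ vᶜ := by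
        refine closure_minimal (sUnion_subset fun e he => ?_) hv.compl.isClosed
        exact (hU1 he).2.subset_compl_right
      exact disjoint_compl_left.mono_left this
    obtain ⟨y, hy⟩ := hne
    obtain ⟨x, hx, hxE⟩ := hclo 𝒰 (fun e he => (hU1 he).1) hU2
      ⟨y, fun hc => disjoint_left.1 hUv hc hy⟩
    by_cases hxv : x ∈ v
    · obtain ⟨b, hb⟩ := hP2 x v hv.isOpen hxv
      exact hcon _ (hxE b) hb
    · obtain ⟨b, hb⟩ := hP2 x ((closure (⋃₀ 𝒰))ᶜ ∩ vᶜ)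
        (isClosed_closure.isOpen_compl.inter hv.compl.isOpen) ⟨hx, hxv⟩
      obtain ⟨h, hh, z, hz1, hz2⟩ := hU3 (P x b) ⟨hxE b, disjoint_left.2 fun z hz hzv =>
        (hb hz).2 hzv⟩ (hP1 x b).2
      exact (hb hz2).1 (subset_closure ⟨h, hh, hz1⟩)
  -- count
  choose M hM1 hM2 hM3 using fun c : Set X => exists_max_disj {e ∈ E | e ⊆ c}
  refine le_trans ?_ (mk_small_subsets hEc hr hrΓ hΓ)
  refine mk_le_of_injective (f := fun c : {c : Set X // IsClopen c} =>
    (⟨{e : E | e.1 ∈ M c.1}, ?_⟩ : {M : Set E | #M < r})) ?_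
  · refine lt_of_le_of_lt ?_ (hcard (M c.1) (fun e he => (hM1 _ he).1) (hM2 _))
    refine mk_le_of_injective (f := fun e : {e : E | e.1 ∈ M c.1} => (⟨e.1.1, e.2⟩ : M c.1)) ?_
    intro e e' h
    simp only [Subtype.mk.injEq] at h
    exact Subtype.ext (Subtype.ext h)
  · have key : ∀ c c' : {c : Set X // IsClopen c},
        {e : E | e.1 ∈ M c.1} = {e : E | e.1 ∈ M c'.1} → c.1 ⊆ c'.1 := by
      intro c c' h
      by_contra hcon
      obtain ⟨e, he, hes⟩ := hpi (c.1 \ c'.1) (c.2.diff c'.2) (nonempty_of_not_subset hcon)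
      obtain ⟨m, hm, z, hz1, hz2⟩ := hM3 c.1 e ⟨he, hes.trans sdiff_subset⟩ (hE1 e he).2
      have hmE := (hM1 _ hm).1
      have : (⟨m, hmE⟩ : E) ∈ {e : E | e.1 ∈ M c'.1} := h ▸ hm
      exact (hes hz2).2 ((hM1 _ this).2 hz1)
    intro c c' h
    simp only [Subtype.mk.injEq] at h
    exact Subtype.ext ((key c c' h).antisymm (key c' c h.symm))

end
end Sh
end

section
open Cardinal Set
namespace Sh

section
variable {X : Type u} [TopologicalSpace X]

theorem erdosTarski' {r : Cardinal.{u}} (hr : r = max (rr (Set.univ : Set X)) ℵ₀) {ι : Type u}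
    (hι : #ι < r) (f : ι → Cardinal.{u}) (hf : ∀ j, f j < r) : ∃ σ < r, ∀ j, f j ≤ σ := by
  rcases lt_or_ge ℵ₀ (rr (Set.univ : Set X)) with h | h
  · rw [max_eq_left h.le] at hr
    subst hr
    exact erdosTarski h hι f hf
  · rw [max_eq_right h] at hr
    subst hr
    have : Finite ι := lt_aleph0_iff_finite.1 hι
    choose k hk using fun j => lt_aleph0.1 (hf j)
    obtain ⟨N, hN⟩ := Finite.exists_le k
    exact ⟨N, natCast_lt_aleph0, fun j => by rw [hk j]; exact_mod_cast hN j⟩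

namespace Ctx
variable {mu kap kst : Cardinal.{u}} (h : Ctx X mu kap kst)
variable [CompactSpace X] [T2Space X] [TotallyDisconnectedSpace X]
include h

theorem bdAleph0 : BdS (KF X) mu ℵ₀ := by
  obtain ⟨ν, hν, hb⟩ := h.bdF2
  refine ⟨max ν ℵ₀, max_lt hν h.am, fun n hn => ?_⟩
  rcases lt_or_ge n ℵ₀ with h1 | h1
  · exact pow_fin_le (le_max_right _ _) (le_max_right _ _) h1
  · calc ℵ₀ ^ n ≤ (2 ^ ℵ₀) ^ n := power_le_power_right (cantor _).le
      _ = 2 ^ (ℵ₀ * n) := power_mul.symm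
      _ = 2 ^ n := by rw [aleph0_mul_eq h1]
      _ ≤ _ := (hb n hn).trans (le_max_left _ _)

theorem bdClopen : BdS (KF X) mu #{c : Set X // IsClopen c} := by
  by_contra hbad
  let χ := sInf {α | mu ≤ α ∨ ¬ BdS (KF X) mu α}
  have hmem : mu ≤ χ ∨ ¬ BdS (KF X) mu χ :=
    csInf_mem (s := {α | mu ≤ α ∨ ¬ BdS (KF X) mu α}) ⟨mu, Or.inl le_rfl⟩
  have hχmu : χ ≤ mu := csInf_le' (Or.inl le_rfl)
  have hγ : ∀ α < χ, BdS (KF X) mu α := by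
    intro α hα
    by_contra hc
    exact absurd (csInf_le' (s := {α | mu ≤ α ∨ ¬ BdS (KF X) mu α}) (Or.inr hc)) (not_le.2 hα)
  have hχC : χ ≤ #{c : Set X // IsClopen c} := csInf_le' (Or.inr hbad)
  have hχ1 : ℵ₀ < χ := by
    by_contra hc
    push Not at hc
    rcases hmem with h1 | h1
    · exact absurd (h1.trans hc) (not_le.2 h.am)
    · rcases hc.lt_or_eq with h2 | h2
      · exact h1 (BdS.of_finite h.am h.bdF2 h2)
      · rw [h2] at h1; exact h1 h.bdAleph0
  have hχ0 := hχ1.le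
  have hmul : ∀ n m, KF X n → KF X m → KF X (n * m) := fun n m => KF.mul
  have P1 : ∀ α < χ, ∀ σ, KF X σ → α ^ σ < χ := by
    intro α hα σ hσ
    rcases hmem with h1 | h1
    · obtain ⟨ν, hν, hb⟩ := hγ α hα
      exact ((hb σ hσ).trans_lt hν).trans_le h1
    · exact BdS.pow_lt hmul h1 hγ hα hσ
  have h2χ : (2 : Cardinal.{u}) < χ := (ofNat_lt_aleph0 (n := 2)).trans hχ1
  have h1χ : (1 : Cardinal.{u}) < χ := one_lt_aleph0.trans hχ1
  have hs : ∃ β0 < χ, ∀ σ, KK X σ → σ ≤ β0 := by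
    by_contra hcon
    push Not at hcon
    have hsl : ∀ a < χ, 2 ^ a < χ := by
      intro a ha
      obtain ⟨σ, hσ, haσ⟩ := hcon a ha
      exact P1 2 h2χ a (Or.inl (hσ.mono haσ.le))
    have hχk : χ ≤ kst := h.mx χ hχ0 hsl (hχmu.trans h.ml)
    rcases hmem with h1 | h1
    · obtain ⟨ν, hν, hb⟩ := h.bdF2
      obtain ⟨σ, hσ, haσ⟩ := hcon ν (hν.trans_le h1)
      exact absurd (haσ.trans (cantor σ)) (not_lt.2 (hb σ (Or.inl hσ)))
    · rcases lt_or_ge χ mu with h2 | h2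
      · obtain ⟨z, hz, ι, c, rfl, hc, hsum⟩ := BdS.exists_cof hmul hχ0 h2 h1 hγ
        have hzk : #ι < kst := ((cantor _).trans (P1 2 h2χ _ hz)).trans_le hχk
        exact h1 ⟨χ ^ #ι, h.F1 _ h2 _ hzk, fun n hn => pow_le_of_cof hsum
          (fun i => (P1 _ (add_lt_of_lt hχ0 (hc i) h1χ) n hn).le)⟩
      · obtain ⟨ν, hν, hb⟩ := h.bdF2
        obtain ⟨σ, hσ, haσ⟩ := hcon ν (hν.trans_le h2)
        exact absurd (haσ.trans (cantor σ)) (not_lt.2 (hb σ (Or.inl hσ)))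
  obtain ⟨β0, hβ0, hK0⟩ := hs
  obtain ⟨β, hβdef⟩ : ∃ β, β = max β0 ℵ₀ := ⟨_, rfl⟩
  have hβχ : β < χ := hβdef ▸ max_lt hβ0 hχ1
  have hβ : ℵ₀ ≤ β := hβdef ▸ le_max_right _ _
  have hK : ∀ σ, KK X σ → σ ≤ β := fun σ hσ => (hK0 σ hσ).trans (hβdef ▸ le_max_left _ _)
  have hβ0' : β ≠ 0 := (aleph0_pos.trans_le hβ).ne'
  have h2β : (2 : Cardinal.{u}) ≤ β := (ofNat_lt_aleph0 (n := 2)).le.trans hβ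
  obtain ⟨r, hr⟩ : ∃ r, r = max (rr (Set.univ : Set X)) ℵ₀ := ⟨_, rfl⟩
  have hr0 : ℵ₀ ≤ r := hr ▸ le_max_right _ _
  have hrK : ∀ σ < r, KF X σ := by
    intro σ hσ
    rw [hr] at hσ
    rcases lt_max_iff.1 hσ with h1 | h1
    · exact Or.inl (lt_rr.1 h1).kk
    · exact Or.inr h1
  obtain ⟨Γ, hΓdef⟩ : ∃ Γ, Γ = sInf {ν | ∀ σ < r, β ^ σ ≤ ν} := ⟨_, rfl⟩
  have hΓa : ∀ σ < r, β ^ σ ≤ Γ := by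
    have := csInf_mem (s := {ν | ∀ σ < r, β ^ σ ≤ ν})
      ⟨β ^ r, fun σ hσ => power_le_power_left hβ0' hσ.le⟩
    rw [← hΓdef] at this
    exact this
  have hΓle : ∀ ν, (∀ σ < r, β ^ σ ≤ ν) → Γ ≤ ν := fun ν hν => hΓdef ▸ csInf_le' hν
  have hΓb : ∀ c < Γ, ∃ σ < r, c < β ^ σ := by
    intro c hc
    by_contra hcon
    push Not at hcon
    exact absurd (hΓle c hcon) (not_le.2 hc)
  have hβΓ : β ≤ Γ := by simpa using hΓa 1 (one_lt_aleph0.trans_le hr0)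
  have hrΓ : r ≤ Γ := by
    by_contra hc
    exact absurd ((cantor Γ).trans_le (power_le_power_right h2β)) (not_lt.2 (hΓa _ (not_le.1 hc)))
  have hΓ0 := hβ.trans hβΓ
  have hsumb : ∀ (ι : Type u) (c : ι → Cardinal.{u}), #ι < r → (∀ j, c j < Γ) →
      ∃ τ < r, Cardinal.sum c ≤ β ^ τ := by
    intro ι c hι hc
    choose τ hτ hcτ using fun j => hΓb (c j) (hc j)
    obtain ⟨σ, hσ, hb⟩ := erdosTarski' hr hι τ hτ
    refine ⟨#ι + σ, add_lt_of_lt hr0 hι hσ, ?_⟩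
    calc Cardinal.sum c ≤ Cardinal.sum (fun _ : ι => β ^ σ) :=
          sum_le_sum _ _ fun j => (hcτ j).le.trans (power_le_power_left hβ0' (hb j))
      _ = #ι * β ^ σ := by simp
      _ ≤ β ^ #ι * β ^ σ := mul_le_mul_left ((cantor _).le.trans (power_le_power_right h2β)) _
      _ = β ^ (#ι + σ) := by rw [power_add]
  have hΓpow : ∀ σ < r, Γ ^ σ ≤ Γ := by
    intro σ hσ
    rcases cofDich Γ σ hΓ0 with ⟨ι, c, rfl, hc, hsum⟩ | hB
    · obtain ⟨τ, hτ, hle⟩ := hsumb ι c hσ hc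
      calc Γ ^ #ι ≤ (β ^ τ) ^ #ι := power_le_power_right (hsum.trans hle)
        _ = β ^ (τ * #ι) := power_mul.symm
        _ ≤ Γ := hΓa _ (mul_lt_of_lt hr0 hτ hσ)
    · have := hB Γ (by
        intro α hα
        obtain ⟨τ, hτ, hατ⟩ := hΓb α hα
        calc α ^ σ ≤ (β ^ τ) ^ σ := power_le_power_right hατ.le
          _ = β ^ (τ * σ) := power_mul.symm
          _ ≤ Γ := hΓa _ (mul_lt_of_lt hr0 hτ hσ))
      rwa [mul_eq_self hΓ0] at this
  have hΓχ : Γ < χ := by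
    rcases le_or_gt mu χ with h1 | h1
    · obtain ⟨ν, hν, hb⟩ := hγ β hβχ
      exact ((hΓle ν (fun σ hσ => hb σ (hrK σ hσ))).trans_lt hν).trans_le h1
    · obtain ⟨z, hz, ι, c, rfl, hc, hsum⟩ := BdS.exists_cof hmul hχ0 h1
        (hmem.resolve_left (not_le.2 h1)) hγ
      rcases lt_or_ge #ι r with h2 | h2
      · by_contra hcon
        push Not at hcon
        obtain ⟨τ, hτ, hle⟩ := hsumb ι c h2 (fun j => (hc j).trans_le hcon)
        exact absurd (P1 β hβχ τ (hrK τ hτ)) (not_lt.2 (hsum.trans hle))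
      · exact (hΓle _ (fun σ hσ => power_le_power_left hβ0' (hσ.le.trans h2))).trans_lt
          (P1 β hβχ _ hz)
  have := clopen_count hβ hK hr0 (fun n hn => hr ▸ lt_max_of_lt_left (lt_rr.2 hn)) hrΓ hβΓ hΓpow
  exact absurd (this.trans_lt hΓχ) (not_lt.2 hχC)

end Ctx
end
end Sh
end

section
open Cardinal Set
namespace Sh

section
variable {X : Type u} [TopologicalSpace X]

/-- pieces of a code -/
def QQ (M : Set X) (C : Set {c : Set X // IsClopen c}) (c : C) : Set X :=
  (M ∩ c.1.1) \ ⋃ d : {d : C // d ≠ c}, d.1.1.1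

theorem QQ_sep (M : Set X) (C : Set {c : Set X // IsClopen c}) : Sep (QQ M C) := by
  refine ⟨fun c => c.1.1, fun c => c.1.2.isOpen, fun c x hx => hx.1.2, fun c d hcd => ?_⟩
  rw [disjoint_left]
  intro x hx hxc
  exact hx.2 (mem_iUnion.2 ⟨⟨c, hcd⟩, hxc⟩)

theorem exists_code [CompactSpace X] [T2Space X] [TotallyDisconnectedSpace X]
    (ν : Cardinal.{u}) (L U : Set X) (hU : IsOpen U) :
    ∃ C : Set {c : Set X // IsClopen c}, KK X #C ∧ (∀ c ∈ C, oN (L ∩ c.1) ≤ ν) ∧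
      WL ν L \ U = WL ν L ∩ closure ((⋃ c, QQ (WL ν L) C c) \ U) := by
  classical
  let M := WL ν L
  let A : Set {c : Set X // IsClopen c} :=
    {c | oN (L ∩ c.1) ≤ ν ∧ (c.1 ∩ (M \ U)).Nonempty}
  obtain ⟨C, hC⟩ := zorn_subset {C : Set {c : Set X // IsClopen c} | C ⊆ A ∧
      C.PairwiseDisjoint (fun c => c.1 ∩ (M \ U))} (by
    intro c hc hch
    refine ⟨⋃₀ c, ⟨sUnion_subset fun s hs => (hc hs).1, ?_⟩, fun s hs => subset_sUnion_of_mem hs⟩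
    exact (pairwiseDisjoint_sUnion hch.directedOn).2 (fun s hs => (hc hs).2))
  have hCA := hC.prop.1
  have hCd := hC.prop.2
  have hsub : ∀ c : C, c.1.1 ∩ (M \ U) ⊆ QQ M C c := by
    rintro c x ⟨hxc, hxM, hxU⟩
    refine ⟨⟨hxM, hxc⟩, ?_⟩
    simp only [mem_iUnion, not_exists]
    rintro ⟨d, hd⟩ hxd
    exact disjoint_left.1 (hCd d.2 c.2 (fun hc => hd (Subtype.ext hc))) ⟨hxd, hxM, hxU⟩
      ⟨hxc, hxM, hxU⟩
  refine ⟨C, ?_, fun c hc => (hCA hc).1, ?_⟩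
  · refine (QQ_sep M C).kk (fun c => (hCA c.2).2.mono (hsub c))
  · apply Subset.antisymm
    · rintro y ⟨hyM, hyU⟩
      refine ⟨hyM, ?_⟩
      rw [mem_closure_iff]
      intro o ho hyo
      obtain ⟨w, hw, hyw, hwo⟩ := exists_clopen ho hyo
      obtain ⟨hyL, v, hv, hyv, hvν⟩ := hyM
      have hyM : y ∈ M := ⟨hyL, v, hv, hyv, hvν⟩
      let e : {c : Set X // IsClopen c} := ⟨v ∩ w, hv.inter hw⟩
      have heA : e ∈ A := ⟨(oN_mono (inter_subset_inter_right _ inter_subset_left)).trans hvν,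
        y, ⟨hyv, hyw⟩, hyM, hyU⟩
      have hmeet : ∃ c ∈ C, ((c.1 ∩ (M \ U)) ∩ (e.1 ∩ (M \ U))).Nonempty := by
        by_contra hcon
        push Not at hcon
        have h1 : insert e C ∈ {C : Set {c : Set X // IsClopen c} | C ⊆ A ∧
            C.PairwiseDisjoint (fun c => c.1 ∩ (M \ U))} := by
          refine ⟨insert_subset heA hCA, hCd.insert ?_⟩
          intro c hc _
          exact (disjoint_iff_inter_eq_empty.2 (hcon c hc)).symm
        have h2 : e ∈ C := hC.le_of_ge h1 (subset_insert _ _) (mem_insert _ _)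
        have := hcon e h2
        rw [inter_self] at this
        exact heA.2.ne_empty this
      obtain ⟨c, hc, z, hz1, hz2⟩ := hmeet
      exact ⟨z, hwo hz2.1.2, mem_iUnion.2 ⟨⟨c, hc⟩, hsub ⟨c, hc⟩ hz1⟩, hz1.2.2⟩
    · rintro y ⟨hyM, hy⟩
      refine ⟨hyM, fun hyU => ?_⟩
      obtain ⟨z, hz1, hz2⟩ := mem_closure_iff.1 hy U hU hyU
      exact hz2.2 hz1

namespace Ctx
variable {mu kap kst : Cardinal.{u}} (h : Ctx X mu kap kst)
variable [CompactSpace X] [T2Space X] [TotallyDisconnectedSpace X]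
include h

theorem codes_bound : ∃ ν < mu, #{C : Set {c : Set X // IsClopen c} | KK X #C} ≤ ν := by
  obtain ⟨ν0, hν0, hb0⟩ := h.bdF2
  obtain ⟨ν3, hν3, hb3⟩ := h.bdClopen
  refine ⟨ν0 * ν3, mul_lt_of_lt h.am.le hν0 hν3, ?_⟩
  let J := {i : ν0.ord.ToType // KF X #(Iio i)}
  have hex : ∀ C : {C : Set {c : Set X // IsClopen c} | KK X #C},
      ∃ (i : J) (g : Iio i.1 → {c : Set X // IsClopen c}), range g = C.1 := by
    intro C
    obtain ⟨i, hi⟩ := exists_iio_eq ((cantor _).trans_le (hb0 _ (Or.inl C.2)))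
    obtain ⟨e⟩ := Cardinal.eq.1 hi
    refine ⟨⟨i, hi ▸ Or.inl C.2⟩, fun j => (e j).1, ?_⟩
    ext x
    constructor
    · rintro ⟨j, rfl⟩; exact (e j).2
    · intro hx; exact ⟨e.symm ⟨x, hx⟩, by simp⟩
  choose i g hg using hex
  have h1 : #{C : Set {c : Set X // IsClopen c} | KK X #C} ≤
      #(Σ i : J, (Iio i.1 → {c : Set X // IsClopen c})) := by
    refine mk_le_of_injective (f := fun M => ⟨i M, g M⟩) ?_
    intro M N h
    have : ∀ p q : (Σ i : J, (Iio i.1 → {c : Set X // IsClopen c})), p = q →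
      range p.2 = range q.2 := by
      rintro p q rfl; rfl
    have := this _ _ h
    simp only [hg] at this
    exact Subtype.ext this
  refine h1.trans ?_
  rw [mk_sigma]
  calc Cardinal.sum (fun i : J => #(Iio i.1 → {c : Set X // IsClopen c}))
      ≤ Cardinal.sum (fun i : J => ν3) := by
        refine sum_le_sum _ _ fun i => ?_
        rw [← power_def]
        exact hb3 _ i.2
    _ = #J * ν3 := by simp
    _ ≤ ν0 * ν3 := by
      refine mul_le_mul' ?_ le_rfl
      have := mk_subtype_le (fun i : ν0.ord.ToType => KF X #(Iio i))
      rwa [mk_ord_toType] at this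

theorem contra : False := by
  classical
  obtain ⟨ν, hν, hν0, Λ, L, hΛ, hcov, hLc, hL⟩ := h.exists_leaves
  obtain ⟨ν2, hν2, hb2⟩ := h.prodBound hν
  obtain ⟨ν4, hν4, hb4⟩ := h.codes_bound
  have hM : ∀ l, oN (WL ν (L l)) ≤ ν4 * ν2 := by
    intro l
    let M := WL ν (L l)
    let Cd : Type u := {C : Set {c : Set X // IsClopen c} |
      KK X #C ∧ ∀ c ∈ C, oN (L l ∩ c.1) ≤ ν}
    have hCd : #Cd ≤ ν4 := (mk_le_mk_of_subset (fun C hC => hC.1)).trans hb4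
    let T : Cd → Type u := fun C => {S : Set X | ∃ U, IsOpen U ∧ S = U ∩ ⋃ c, QQ M C.1 c}
    have hT : ∀ C, #(T C) ≤ ν2 := by
      intro C
      refine hb2 _ (QQ M C.1) (QQ_sep _ _) (fun c => (oN_mono ?_).trans (C.2.2 c.1 c.2))
      exact fun x hx => ⟨hx.1.1.1, hx.1.2⟩
    have hsum : #(Σ C, T C) ≤ ν4 * ν2 := by
      rw [mk_sigma]
      calc Cardinal.sum (fun C => #(T C)) ≤ Cardinal.sum (fun _ : Cd => ν2) := sum_le_sum _ _ hT
        _ = #Cd * ν2 := by simp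
        _ ≤ _ := mul_le_mul' hCd le_rfl
    refine le_trans ?_ hsum
    have : ∀ S : {S : Set X | ∃ U, IsOpen U ∧ S = U ∩ M}, ∃ U, IsOpen U ∧ S.1 = U ∩ M :=
      fun S => S.2
    choose U hU hS using this
    choose C hC1 hC2 hC3 using fun S => exists_code ν (L l) (U S) (hU S)
    refine mk_le_of_injective (f := fun S => (⟨⟨C S, hC1 S, hC2 S⟩,
      ⟨U S ∩ ⋃ c, QQ M (C S) c, U S, hU S, rfl⟩⟩ : Σ C, T C)) ?_
    intro S S' hSS
    have hex : ∀ p q : (Σ C, T C), p = q → p.1.1 = q.1.1 ∧ p.2.1 = q.2.1 := by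
      rintro p q rfl; exact ⟨rfl, rfl⟩
    obtain ⟨h1, h2⟩ := hex _ _ hSS
    simp only at h1 h2
    have h3 : M \ U S = M \ U S' := by
      have e1 := hC3 S
      have e2 := hC3 S'
      rw [← h1] at e2 h2
      have e3 : (⋃ c, QQ (WL ν (L l)) (C S) c) \ U S = (⋃ c, QQ (WL ν (L l)) (C S) c) \ U S' := by
        ext x
        have := Set.ext_iff.1 h2 x
        simp only [mem_inter_iff, mem_sdiff] at this ⊢
        tauto
      rw [e3] at e1
      exact e1.trans e2.symm
    apply Subtype.ext
    rw [hS S, hS S']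
    ext x
    have := Set.ext_iff.1 h3 x
    simp only [mem_inter_iff, mem_sdiff] at this ⊢
    tauto
  have hLb : ∀ l, oN (L l) ≤ ν4 * ν2 * 2 := by
    intro l
    have hsplit : L l ⊆ WL ν (L l) ∪ (L l \ WL ν (L l)) := by
      intro x hx
      by_cases hxw : x ∈ WL ν (L l)
      · exact Or.inl hxw
      · exact Or.inr ⟨hx, hxw⟩
    refine (oN_mono hsplit).trans ((oN_union _ _).trans (mul_le_mul' (hM l) ?_))
    rcases (L l \ WL ν (L l)).eq_empty_or_nonempty with h0 | ⟨x, hx⟩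
    · rw [h0]
      have : oN (∅ : Set X) ≤ 1 := by
        rw [oN, mk_le_one_iff_set_subsingleton]
        rintro S ⟨U, _, rfl⟩ S' ⟨U', _, rfl⟩
        simp
      exact this.trans Cardinal.one_lt_two.le
    · have : L l \ WL ν (L l) ⊆ {x} := fun y hy => (hL l).bad_unique hy hx
      exact (oN_mono this).trans (oN_singleton_le x)
  have hlt : ν4 * ν2 * 2 < mu := mul_lt_of_lt h.am.le (mul_lt_of_lt h.am.le hν4 hν2)
    ((ofNat_lt_aleph0 (n := 2)).trans h.am)
  have hcov' : (Set.univ : Set X) ⊆ ⋃ l, L l := fun x _ => mem_iUnion.2 (hcov x)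
  have := (oN_le_of_cover L hcov' hLb).trans_lt (h.F1 _ hlt _ hΛ)
  exact absurd this (not_lt.2 h.ml)

end Ctx
end
end Sh
end

section
open Cardinal Set
namespace Sh

theorem topo {X : Type u} [TopologicalSpace X] [CompactSpace X] [T2Space X]
    [TotallyDisconnectedSpace X] (hb : beth Ordinal.omega0 ≤ oN (Set.univ : Set X)) :
    oN (Set.univ : Set X) ^ beth Ordinal.omega0 ≤ oN (Set.univ : Set X) := by
  obtain ⟨l, hl⟩ : ∃ l, l = oN (Set.univ : Set X) := ⟨_, rfl⟩
  let A : Set Cardinal.{u} := {χ | ℵ₀ ≤ χ ∧ (∀ a < χ, 2 ^ a < χ) ∧ χ ≤ l}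
  have hbA : beth Ordinal.omega0 ∈ A := ⟨aleph0_le_beth _,
    fun a ha => (isStrongLimit_beth.2 Ordinal.isSuccLimit_omega0.isSuccPrelimit).isStrongPrelimit ha,
    hl ▸ hb⟩
  have hAb : BddAbove A := ⟨l, fun χ hχ => hχ.2.2⟩
  have hAn : A.Nonempty := ⟨_, hbA⟩
  obtain ⟨kst, hk⟩ : ∃ k, k = sSup A := ⟨_, rfl⟩
  have hbk : beth Ordinal.omega0 ≤ kst := hk ▸ le_csSup hAb hbA
  have sl : ∀ a < kst, 2 ^ a < kst := by
    intro a ha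
    rw [hk] at ha
    obtain ⟨χ, hχ, haχ⟩ := exists_lt_of_lt_csSup hAn ha
    exact (hχ.2.1 a haχ).trans_le (hk ▸ le_csSup hAb hχ)
  have hkl : kst ≤ l := hk ▸ csSup_le hAn (fun χ hχ => hχ.2.2)
  have hnat : ∀ n : ℕ, beth (n : Ordinal.{u}) < kst := fun n =>
    (beth_lt_beth.2 (Ordinal.natCast_lt_omega0 n)).trans_le hbk
  have al : ℵ₀ < kst := by simpa using hnat 0
  have hl1 : 1 ≤ l := one_le_aleph0.trans (al.le.trans hkl)
  have G : ∀ ρ < kst, l ^ ρ ≤ l := by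
    by_contra hcon
    push Not at hcon
    let S : Set Cardinal.{u} := {m | ∃ ρ < kst, l < m ^ ρ}
    have hlS : l ∈ S := hcon
    obtain ⟨mu, hmu⟩ : ∃ m, m = sInf S := ⟨_, rfl⟩
    have hmS : mu ∈ S := hmu ▸ csInf_mem ⟨l, hlS⟩
    have hml : mu ≤ l := hmu ▸ csInf_le' hlS
    have hmin : ∀ α < mu, ∀ ρ < kst, α ^ ρ ≤ l := by
      intro α hα ρ hρ
      by_contra hc
      rw [hmu] at hα
      exact absurd (csInf_le' (s := S) ⟨ρ, hρ, not_le.1 hc⟩) (not_le.2 hα)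
    obtain ⟨ρ0, hρ0, hlρ⟩ := hmS
    have hmu0 : mu ≠ 0 := by
      rintro h0
      rw [h0] at hlρ
      exact absurd (hlρ.trans_le (zero_power_le _)) (not_lt.2 hl1)
    obtain ⟨kap, hkap⟩ : ∃ k, k = max ρ0 ℵ₀ := ⟨_, rfl⟩
    have kl : kap < kst := hkap ▸ max_lt hρ0 al
    have lm : l < mu ^ kap := hlρ.trans_le (power_le_power_left hmu0 (hkap ▸ le_max_left _ _))
    have hctx : Ctx X mu kap kst := 
      { sl := sl
        al := al
        kl := kl
        ka := hkap ▸ le_max_right _ _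
        ml := hl ▸ hml
        lm := hl ▸ lm
        F1 := by
          intro α hα ρ hρ
          by_contra hc
          have h1 : mu ^ kap ≤ α ^ (ρ * kap) := by
            rw [power_mul]; exact power_le_power_right (not_lt.1 hc)
          exact absurd (h1.trans (hmin α hα _ (mul_lt_of_lt al.le hρ kl))) (not_le.2 lm)
        km := by
          by_contra hc
          have h1 : mu ^ kap ≤ 2 ^ (mu * kap) := by
            rw [power_mul]; exact power_le_power_right (cantor _).le
          exact absurd ((h1.trans (sl _ (mul_lt_of_lt al.le (not_le.1 hc) kl)).le).trans hkl)
            (not_le.2 lm)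
        mx := fun χ h1 h2 h3 => hk ▸ le_csSup hAb ⟨h1, h2, hl ▸ h3⟩ }
    exact hctx.contra
  rw [← hl]
  have hsum : beth Ordinal.omega0.{u} ≤
      Cardinal.sum (fun n : ULift.{u} ℕ => beth (n.down : Ordinal.{u})) := by
    rw [beth_limit Ordinal.isSuccLimit_omega0]
    refine ciSup_le' ?_
    rintro ⟨a, ha⟩
    obtain ⟨n, rfl⟩ := Ordinal.lt_omega0.1 ha
    exact le_sum (fun n : ULift.{u} ℕ => beth (n.down : Ordinal.{u})) ⟨n⟩
  calc l ^ beth Ordinal.omega0.{u}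
      ≤ l ^ Cardinal.sum (fun n : ULift.{u} ℕ => beth (n.down : Ordinal.{u})) :=
        power_le_power_left (zero_lt_one.trans_le hl1).ne' hsum
    _ = Cardinal.prod (fun n : ULift.{u} ℕ => l ^ beth (n.down : Ordinal.{u})) := power_sum _ _
    _ ≤ Cardinal.prod (fun n : ULift.{u} ℕ => l) :=
        Cardinal.prod_le_prod _ _ (fun n => G _ (hnat n.down))
    _ = l ^ ℵ₀ := by simp
    _ ≤ l := G _ al

section Stone
variable (B : Type u) [BooleanAlgebra B]

/-- the Stone space -/
def stone : Set (B → Bool) := {f | (∀ a b, f (a ⊔ b) = (f a || f b)) ∧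
  (∀ a b, f (a ⊓ b) = (f a && f b)) ∧ (∀ a, f aᶜ = !f a) ∧ f ⊤ = true}

theorem isClosed_stone : IsClosed (stone B) := by
  have e : stone B = (⋂ a, ⋂ b, {f : B → Bool | f (a ⊔ b) = (f a || f b)}) ∩
      ((⋂ a, ⋂ b, {f : B → Bool | f (a ⊓ b) = (f a && f b)}) ∩
      ((⋂ a, {f : B → Bool | f aᶜ = !f a}) ∩ {f : B → Bool | f ⊤ = true})) := by
    ext f
    simp [stone]
  rw [e]
  have c2 : ∀ g : Bool × Bool → Bool, Continuous g := fun g => continuous_of_discreteTopology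
  have c1 : ∀ g : Bool → Bool, Continuous g := fun g => continuous_of_discreteTopology
  have d1 : ∀ a b, Continuous (fun f : B → Bool => (f a || f b)) := by
    intro a b
    have h := (c2 fun p => p.1 || p.2).comp
      (Continuous.prodMk (continuous_apply (A := fun _ : B => Bool) a)
        (continuous_apply (A := fun _ : B => Bool) b))
    exact h
  have d2 : ∀ a b, Continuous (fun f : B → Bool => (f a && f b)) := by
    intro a b
    have h := (c2 fun p => p.1 && p.2).comp
      (Continuous.prodMk (continuous_apply (A := fun _ : B => Bool) a)
        (continuous_apply (A := fun _ : B => Bool) b))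
    exact h
  have d3 : ∀ a, Continuous (fun f : B → Bool => !f a) := fun a =>
    (c1 fun p => !p).comp (continuous_apply a)
  refine IsClosed.inter ?_ (IsClosed.inter ?_ (IsClosed.inter ?_ ?_))
  · exact isClosed_iInter fun a => isClosed_iInter fun b => isClosed_eq
      (continuous_apply _) (d1 a b)
  · exact isClosed_iInter fun a => isClosed_iInter fun b => isClosed_eq
      (continuous_apply _) (d2 a b)
  · exact isClosed_iInter fun a => isClosed_eq (continuous_apply _) (d3 a)
  · exact isClosed_eq (continuous_apply _) continuous_const

instance : CompactSpace (stone B) := isCompact_iff_compactSpace.1 (isClosed_stone B).isCompact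

variable {B}

theorem stone_mono {f : B → Bool} (hf : f ∈ stone B) {a b : B} (h : a ≤ b) (ha : f a = true) :
    f b = true := by
  have := hf.1 a b
  rw [sup_eq_right.2 h] at this
  rw [this, ha]; simp

theorem stone_bot {f : B → Bool} (hf : f ∈ stone B) : f ⊥ = false := by
  have := hf.2.2.1 ⊤
  rw [compl_top, hf.2.2.2] at this
  simpa using this

theorem stone_sep (I : Set B) (hne : I.Nonempty) (hd : ∀ a ∈ I, ∀ b : B, b ≤ a → b ∈ I)
    (hs : ∀ a ∈ I, ∀ b ∈ I, a ⊔ b ∈ I) (a : B) (ha : a ∉ I) :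
    ∃ f ∈ stone B, f a = true ∧ ∀ b ∈ I, f b = false := by
  classical
  let J : Order.Ideal B := ⟨⟨I, fun x y hyx hx => hd x hx y hyx⟩, hne,
    fun x hx y hy => ⟨x ⊔ y, hs x hx y hy, le_sup_left, le_sup_right⟩⟩
  have hdis : Disjoint ((Order.PFilter.principal a : Order.PFilter B) : Set B) (J : Set B) := by
    rw [disjoint_left]
    intro x hx hxJ
    exact ha (hd x hxJ a hx)
  obtain ⟨K, hK, hJK, hFK⟩ := DistribLattice.prime_ideal_of_disjoint_filter_ideal hdis
  have htop : (⊤ : B) ∉ K := fun hc => disjoint_left.1 hFK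
    (show (⊤ : B) ∈ (Order.PFilter.principal a : Order.PFilter B) from le_top) hc
  refine ⟨fun b => decide (b ∉ K), ⟨?_, ?_, ?_, by simpa using htop⟩, ?_, ?_⟩
  · intro x y
    rw [Bool.eq_iff_iff]
    simp only [decide_eq_true_eq, Bool.or_eq_true, Order.Ideal.sup_mem_iff]
    tauto
  · intro x y
    rw [Bool.eq_iff_iff]
    simp only [decide_eq_true_eq, Bool.and_eq_true]
    constructor
    · intro h
      exact ⟨fun hx => h (K.lower inf_le_left hx), fun hy => h (K.lower inf_le_right hy)⟩
    · rintro ⟨h1, h2⟩ h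
      exact (hK.mem_or_mem h).elim h1 h2
  · intro x
    rw [Bool.eq_iff_iff]
    simp only [decide_eq_true_eq, Bool.not_eq_true', decide_eq_false_iff_not, not_not]
    constructor
    · intro h
      exact hK.mem_or_compl_mem.resolve_right h
    · intro h hc
      apply htop
      have := Order.Ideal.sup_mem h hc
      rwa [sup_compl_eq_top] at this
  · simp only [decide_eq_true_eq]
    exact fun hc => disjoint_left.1 hFK
      (show a ∈ (Order.PFilter.principal a : Order.PFilter B) from le_rfl) hc
  · intro b hb
    simp only [decide_eq_false_iff_not, not_not]
    exact hJK hb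

theorem stone_basis {U : Set (stone B)} (hU : IsOpen U) {f : stone B} (hf : f ∈ U) :
    ∃ a, f.1 a = true ∧ ∀ g : stone B, g.1 a = true → g ∈ U := by
  classical
  obtain ⟨V, hV, rfl⟩ := isOpen_induced_iff.1 hU
  obtain ⟨S, u, hu, hSu⟩ := isOpen_pi_iff.1 hV f.1 hf
  refine ⟨S.inf (fun b => if f.1 b then b else bᶜ), ?_, ?_⟩
  · clear hu hSu
    induction S using Finset.induction_on with
    | empty => simpa using f.2.2.2.2
    | insert b S _ ih =>
      rw [Finset.inf_insert, f.2.2.1, ih, Bool.and_true]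
      by_cases hb : f.1 b = true
      · simp [hb]
      · simp only [hb]
        rw [if_neg (by simp), f.2.2.2.1]
        simpa using hb
  · intro g hg
    apply hSu
    intro b hb
    have h1 : g.1 (if f.1 b then b else bᶜ) = true := stone_mono g.2
      (Finset.inf_le (f := fun b => if f.1 b then b else bᶜ) hb) hg
    have h2 : g.1 b = f.1 b := by
      by_cases hfb : f.1 b = true
      · rw [if_pos hfb] at h1; rw [h1, hfb]
      · rw [if_neg hfb, g.2.2.2.1] at h1
        simp only [Bool.not_eq_true] at hfb
        rw [hfb]; simpa using h1
    rw [h2]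
    exact (hu b hb).2

theorem mk_ideals : #{I : Set B | I.Nonempty ∧ (∀ a ∈ I, ∀ b : B, b ≤ a → b ∈ I) ∧
      ∀ a ∈ I, ∀ b ∈ I, a ⊔ b ∈ I} = oN (Set.univ : Set (stone B)) := by
  have hop : ∀ I : Set B, IsOpen {f : stone B | ∃ a ∈ I, f.1 a = true} := by
    intro I
    have : {f : stone B | ∃ a ∈ I, f.1 a = true} = ⋃ a ∈ I, {f : stone B | f.1 a = true} := by
      ext f; simp
    rw [this]
    refine isOpen_biUnion fun a _ => ?_
    have hc : Continuous (fun f : stone B => f.1 a) :=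
      (continuous_apply a).comp continuous_subtype_val
    exact (isOpen_discrete {true}).preimage hc
  rw [oN]
  refine mk_congr (Equiv.ofBijective (fun I => ⟨{f : stone B | ∃ a ∈ I.1, f.1 a = true},
    _, hop I.1, by simp⟩) ⟨?_, ?_⟩)
  · have key : ∀ I J : {I : Set B | I.Nonempty ∧ (∀ a ∈ I, ∀ b : B, b ≤ a → b ∈ I) ∧
        ∀ a ∈ I, ∀ b ∈ I, a ⊔ b ∈ I}, {f : stone B | ∃ a ∈ I.1, f.1 a = true} =
        {f : stone B | ∃ a ∈ J.1, f.1 a = true} → I.1 ⊆ J.1 := by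
      intro I J h a ha
      by_contra hc
      obtain ⟨f, hf, hfa, hfb⟩ := stone_sep J.1 J.2.1 J.2.2.1 J.2.2.2 a hc
      have : (⟨f, hf⟩ : stone B) ∈ {f : stone B | ∃ a ∈ J.1, f.1 a = true} := h ▸ ⟨a, ha, hfa⟩
      obtain ⟨b, hb, hfb'⟩ := this
      have h5 := hfb b hb
      exact Bool.false_ne_true (h5.symm.trans hfb')
    intro I J h
    simp only [Subtype.mk.injEq] at h
    exact Subtype.ext ((key I J h).antisymm (key J I h.symm))
  · rintro ⟨S, U, hU, rfl⟩
    refine ⟨⟨{a | ∀ f : stone B, f.1 a = true → f ∈ U}, ⟨⊥, ?_⟩, ?_, ?_⟩, ?_⟩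
    · intro f hf
      rw [stone_bot f.2] at hf
      exact absurd hf Bool.false_ne_true
    · intro a ha b hba f hf
      exact ha f (stone_mono f.2 hba hf)
    · intro a ha b hb f hf
      rw [f.2.1, Bool.or_eq_true] at hf
      exact hf.elim (ha f) (hb f)
    · apply Subtype.ext
      ext f
      simp only [inter_univ]
      constructor
      · rintro ⟨a, ha, hfa⟩
        exact ha f hfa
      · intro hf
        obtain ⟨a, ha, hb⟩ := stone_basis hU hf
        exact ⟨a, hb, ha⟩

end Stone

theorem main (B : Type u) [BooleanAlgebra B]
    (hB : Cardinal.beth Ordinal.omega0 ≤ #B)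
    (lam : Cardinal.{u})
    (hlam : lam = #{I : Set B | I.Nonempty ∧ (∀ a ∈ I, ∀ b : B, b ≤ a → b ∈ I) ∧
      ∀ a ∈ I, ∀ b ∈ I, a ⊔ b ∈ I}) :
    lam = lam ^ Cardinal.beth Ordinal.omega0 := by
  have h1 : #B ≤ lam := by
    rw [hlam]
    refine mk_le_of_injective (f := fun a : B => ⟨Iic a, ⟨a, le_rfl⟩,
      fun x hx y hyx => hyx.trans hx, fun x hx y hy => sup_le hx hy⟩) ?_
    intro a b h
    simp only [Subtype.mk.injEq] at h
    exact Iic_injective h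
  have h2 := hlam.trans mk_ideals
  apply le_antisymm
  · exact self_le_power lam (one_le_aleph0.trans (aleph0_le_beth _))
  · have h3 := topo (X := stone B) (h2 ▸ hB.trans h1)
    rw [← h2] at h3
    exact h3

end Sh
end

open Cardinal

/-- If `B` is a Boolean algebra of cardinality `≥ ℶ_ω` and `λ` is the number of
ideals of `B`, then `λ = λ^{ℶ_ω}`. -/
theorem stmt4 (B : Type u) [BooleanAlgebra B]
    (hB : Cardinal.beth Ordinal.omega0 ≤ #B)
    (lam : Cardinal.{u})
    (hlam : lam = #{I : Set B | I.Nonempty ∧ (∀ a ∈ I, ∀ b : B, b ≤ a → b ∈ I) ∧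
      ∀ a ∈ I, ∀ b ∈ I, a ⊔ b ∈ I}) :
    lam = lam ^ Cardinal.beth Ordinal.omega0 := by
  exact Sh.main B hB lam hlam
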